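/- arXiv:1603.02321 — 4 statements merged into one kernel-verified Lean document; each statement's English description precedes it below -/
import Mathlib

section
/- Let k ≥ 2 be an integer and let C be the cycle graph on the vertex set ℤ/2kℤ, in which i and j are adjacent if and only if i − j = ±1. Then for every subgraph T of C that is a spanning tree (connected and acyclic on all 2k vertices), there exist a vertex v with even representative (i.e., v belongs to the set of k alternating terminal vertices {0, 2, 4, …, 2k−2}) and a vertex u ≠ v such that d_T(v,u) ≥ (2k−1)·d_C(v,u), where d_T and d_C denote the (unweighted) shortest-path graph distances in T and in C respectively. -/
/-- The cycle graph on `ℤ/2kℤ`: `i` and `j` are adjacent iff `i - j = ±1`. -/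
def cycleGraph (k : ℕ) : SimpleGraph (ZMod (2 * k)) :=
  SimpleGraph.fromRel (fun i j => i - j = 1)

theorem SimpleGraph.Walk.le_add_length {V : Type*} {G : SimpleGraph V} (f : V → ℕ)
    (hf : ∀ x y, G.Adj x y → f y ≤ f x + 1) {u v : V} (p : G.Walk u v) :
    f v ≤ f u + p.length := by
  induction p with
  | nil => simp
  | cons h p ih =>
    have := hf _ _ h
    rw [SimpleGraph.Walk.length_cons]
    omega

theorem ZMod.val_le_val_add_one {n : ℕ} [NeZero n] {b : ZMod n} (hb : b + 1 ≠ 0) :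
    b.val ≤ (b + 1).val := by
  have hlt := b.val_lt
  have hne : b.val + 1 ≠ n := by
    intro h
    apply hb
    have h' : ((b.val + 1 : ℕ) : ZMod n) = 0 := by rw [h, ZMod.natCast_self]
    simpa using h'
  have h : ((b.val + 1 : ℕ) : ZMod n).val = b.val + 1 :=
    ZMod.val_natCast_of_lt (by omega)
  have hcast : ((b.val + 1 : ℕ) : ZMod n) = b + 1 := by simp
  rw [hcast] at h
  omega

/-- A tree on `ℤ/nℤ` with `n ≥ 3` omits some edge `{i, i + 1}`. -/
theorem SimpleGraph.IsTree.exists_not_adj_add_one {n : ℕ} (hn : 3 ≤ n)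
    {T : SimpleGraph (ZMod n)} (hT : T.IsTree) : ∃ i, ¬ T.Adj i (i + 1) := by
  classical
  by_contra! h
  have : NeZero n := ⟨by omega⟩
  have htwo : (2 : ZMod n) ≠ 0 := by
    intro h2
    have h2' : ((2 : ℕ) : ZMod n) = 0 := by exact_mod_cast h2
    rw [ZMod.natCast_eq_zero_iff] at h2'
    have := Nat.le_of_dvd (by norm_num) h2'
    omega
  have hcard := hT.card_edgeFinset
  have hle : (Finset.univ : Finset (ZMod n)).card ≤ T.edgeFinset.card := by
    refine Finset.card_le_card_of_injOn (fun x => s(x, x + 1)) (fun x _ => ?_) ?_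
    · simpa using h x
    · intro x _ y _ hxy
      rcases Sym2.eq_iff.mp hxy with hxy | ⟨h1, h2⟩
      · exact hxy.1
      · exact (htwo (by linear_combination h2 - h1)).elim
  rw [Finset.card_univ] at hle
  omega

theorem cycleGraph_adj_add_one {k : ℕ} (hk : 2 ≤ k) (i : ZMod (2 * k)) :
    (cycleGraph k).Adj i (i + 1) := by
  have : Fact (1 < 2 * k) := ⟨by omega⟩
  simp [cycleGraph]

/-- Deleting the edge `{i, i + 1}` from the cycle leaves its ends at distance at least
`2k - 1`. -/
theorem le_dist_of_not_adj_add_one {k : ℕ} (hk : 2 ≤ k) {T : SimpleGraph (ZMod (2 * k))}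
    (hTsub : T ≤ cycleGraph k) (hT : T.Connected) {i : ZMod (2 * k)}
    (hi : ¬ T.Adj i (i + 1)) : 2 * k - 1 ≤ T.dist (i + 1) i := by
  have : NeZero (2 * k) := ⟨by omega⟩
  have : Fact (1 < 2 * k) := ⟨by omega⟩
  obtain ⟨p, hp⟩ := (hT.preconnected (i + 1) i).exists_walk_length_eq_dist
  have hlip : ∀ x y, T.Adj x y → (y - (i + 1)).val ≤ (x - (i + 1)).val + 1 := by
    intro x y hxy
    have hC := hTsub hxy
    simp only [cycleGraph, SimpleGraph.fromRel_adj] at hC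
    rcases hC.2 with h | h
    · obtain rfl : x = y + 1 := by linear_combination h
      have hb : y - (i + 1) + 1 ≠ 0 := by
        intro h0
        obtain rfl : y = i := by linear_combination h0
        exact hi hxy.symm
      have := ZMod.val_le_val_add_one hb
      rw [show y - (i + 1) + 1 = y + 1 - (i + 1) by ring] at this
      omega
    · obtain rfl : y = x + 1 := by linear_combination h
      rw [show x + 1 - (i + 1) = x - (i + 1) + 1 by ring]
      have := ZMod.val_add_le (x - (i + 1)) 1
      rwa [ZMod.val_one] at this
  have hlen := p.le_add_length (fun x => (x - (i + 1)).val) hlip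
  have hneg : (i - (i + 1)).val = 2 * k - 1 := by
    rw [show i - (i + 1) = ((2 * k - 1 : ℕ) : ZMod (2 * k)) by
      rw [Nat.cast_sub (by omega), ZMod.natCast_self]; push_cast; ring]
    exact ZMod.val_natCast_of_lt (by omega)
  simp only [hneg, sub_self, ZMod.val_zero, hp] at hlen
  omega

theorem exists_eq_two_mul_or_add_one {k : ℕ} (hk : 1 ≤ k) (i : ZMod (2 * k)) :
    (∃ j : ℕ, j < k ∧ i = ((2 * j : ℕ) : ZMod (2 * k))) ∨
      ∃ j : ℕ, j < k ∧ i + 1 = ((2 * j : ℕ) : ZMod (2 * k)) := by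
  have : NeZero (2 * k) := ⟨by omega⟩
  have hlt := i.val_lt
  have hi : ((i.val : ℕ) : ZMod (2 * k)) = i := ZMod.natCast_zmod_val i
  rcases Nat.even_or_odd' i.val with ⟨j, hj | hj⟩
  · exact Or.inl ⟨j, by omega, by rw [← hj, hi]⟩
  · right
    have hi' : i + 1 = ((2 * (j + 1) : ℕ) : ZMod (2 * k)) := by
      rw [← hi, hj]; push_cast; ring
    rcases Nat.lt_or_ge (j + 1) k with h | h
    · exact ⟨j + 1, h, hi'⟩
    · refine ⟨0, by omega, ?_⟩
      rw [hi', show j + 1 = k by omega, ZMod.natCast_self]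
      simp

/-- Lower bound for terminal distortion of spanning trees of the cycle `C_{2k}` with the
`k` alternating (even) vertices as terminals: every spanning tree `T` of `C_{2k}` has a
terminal `v` and a vertex `u ≠ v` with `d_T(v,u) ≥ (2k-1)·d_{C_{2k}}(v,u)`. -/
theorem cycle_spanning_tree_terminal_lower_bound (k : ℕ) (hk : 2 ≤ k)
    (T : SimpleGraph (ZMod (2 * k))) (hTsub : T ≤ cycleGraph k) (hT : T.IsTree) :
    ∃ v u : ZMod (2 * k),
      (∃ j : ℕ, j < k ∧ v = ((2 * j : ℕ) : ZMod (2 * k))) ∧ u ≠ v ∧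
      (2 * k - 1) * (cycleGraph k).dist v u ≤ T.dist v u := by
  obtain ⟨i, hi⟩ := hT.exists_not_adj_add_one (by omega)
  have hadj := cycleGraph_adj_add_one hk i
  have hdist := le_dist_of_not_adj_add_one hk hTsub hT.connected hi
  rcases exists_eq_two_mul_or_add_one (by omega) i with h | h
  · refine ⟨i, i + 1, h, hadj.ne', ?_⟩
    rwa [SimpleGraph.dist_eq_one_iff_adj.mpr hadj, mul_one, SimpleGraph.dist_comm]
  · refine ⟨i + 1, i, h, hadj.ne, ?_⟩
    rwa [SimpleGraph.dist_eq_one_iff_adj.mpr hadj.symm, mul_one]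
end

section
/- There exists a universal constant C > 0 such that for every finite metric space (X,d) with |X| = n ≥ 2 and every set of terminals K ⊆ X with |K| = k ≥ 2, there exists a finitely supported probability distribution μ over functions ρ : X × X → ℝ such that: (a) every ρ in the support of μ is an ultrametric dominating d, i.e., ρ(x,x) = 0, ρ(x,y) = ρ(y,x), ρ(x,z) ≤ max(ρ(x,y), ρ(y,z)), and ρ(x,y) ≥ d(x,y) for all x,y,z ∈ X; (b) for every v ∈ K and u ∈ X, the expectation E_{ρ∼μ}[ρ(v,u)] ≤ C·(log k)·d(v,u); and (c) for every u,w ∈ X, E_{ρ∼μ}[ρ(u,w)] ≤ C·(log n)·d(u,w). Here log denotes the natural logarithm. -/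
open Finset

namespace StrongTerminal

/-- A geometric-type sum restricted to the indices whose radius lies in `[a, b)`. -/
lemma sum_increments_le {r : ℕ → ℝ} (hr : Monotone r) {a b ε : ℝ}
    (hstep : ∀ m, r m < b → r (m + 1) - r m ≤ ε) (N : ℕ) :
    ∑ m ∈ range N, (if a ≤ r m ∧ r m < b then r (m + 1) - r m else 0)
      ≤ max 0 (min (r N) (b + ε) - a) := by
  induction N with
  | zero => simp
  | succ N ih =>
    rw [sum_range_succ]
    have hmono : r N ≤ r (N + 1) := hr N.le_succ
    split_ifs with h
    · have h1 := hstep N h.2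
      have h2 : min (r N) (b + ε) - a ≤ r N - a := by linarith [min_le_left (r N) (b + ε)]
      have h3 : max 0 (min (r N) (b + ε) - a) ≤ r N - a :=
        max_le (by linarith [h.1]) h2
      have h4 : min (r (N + 1)) (b + ε) = r (N + 1) := min_eq_left (by linarith [h.2])
      rw [h4]
      exact le_trans (by linarith) (le_max_right _ _)
    · rw [add_zero]
      refine ih.trans (max_le_max le_rfl ?_)
      linarith [min_le_min_right (b + ε) hmono]

lemma sum_increments_le_of_le {r : ℕ → ℝ} (hr : Monotone r) {a b ε : ℝ} (hab : a ≤ b)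
    (hε : 0 ≤ ε) (hstep : ∀ m, r m < b → r (m + 1) - r m ≤ ε) (N : ℕ) :
    ∑ m ∈ range N, (if a ≤ r m ∧ r m < b then r (m + 1) - r m else 0) ≤ b - a + ε := by
  refine (sum_increments_le hr hstep N).trans (max_le (by linarith) ?_)
  linarith [min_le_right (r N) (b + ε)]

lemma sum_range_mul_eq (g : ℕ → ℝ) (M N : ℕ) :
    ∑ i ∈ range N, ∑ j ∈ range M, g (j + i * M) = ∑ m ∈ range (N * M), g m := by
  induction N with
  | zero => simp
  | succ N ih =>
    rw [sum_range_succ, ih, Nat.succ_mul, sum_range_add]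
    simp only [add_comm]

open scoped Classical in
/-- The reciprocals of the ranks of the elements of a finite set sum to at most a harmonic
number. -/
lemma sum_inv_rank_le_harmonic {X : Type*} (S : Finset X) (a : X → ℝ) :
    ∑ c ∈ S, (1 / (#{c' ∈ S | a c' ≤ a c} : ℝ)) ≤ (harmonic #S : ℝ) := by
  induction S using Finset.induction_on_max_value a with
  | empty => simp
  | insert x S hx hmax ih =>
    rw [sum_insert hx, card_insert_of_notMem hx, harmonic_succ]
    have hfull : {c' ∈ insert x S | a c' ≤ a x} = insert x S := by
      apply filter_true_of_mem
      intro c hc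
      rcases mem_insert.1 hc with rfl | hc
      · exact le_rfl
      · exact hmax c hc
    rw [hfull, card_insert_of_notMem hx, add_comm]
    push_cast
    rw [one_div]
    gcongr
    refine le_trans (sum_le_sum fun c hc ↦ ?_) ih
    have hpos : 0 < #{c' ∈ S | a c' ≤ a c} :=
      card_pos.2 ⟨c, mem_filter.2 ⟨hc, le_rfl⟩⟩
    gcongr
    exact subset_insert x S

open scoped Classical in
/-- In a uniformly random order, a given element of `S` comes first in `S` with probability at
most `1 / #S`. -/
lemma card_mul_card_first_le {X : Type*} [Fintype X] {n : ℕ} (S : Finset X) {c : X}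
    (hc : c ∈ S) :
    #S * #{σ : X ≃ Fin n | ∀ c' ∈ S, σ c ≤ σ c'} ≤ Fintype.card (X ≃ Fin n) := by
  have heq : ∀ x ∈ S, #{σ : X ≃ Fin n | ∀ c' ∈ S, σ x ≤ σ c'} =
      #{σ : X ≃ Fin n | ∀ c' ∈ S, σ c ≤ σ c'} := by
    have key : ∀ x ∈ S, ∀ y ∈ S, #{σ : X ≃ Fin n | ∀ c' ∈ S, σ x ≤ σ c'} ≤
        #{σ : X ≃ Fin n | ∀ c' ∈ S, σ y ≤ σ c'} := by
      intro x hx y hy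
      refine card_le_card_of_injOn (fun σ ↦ (Equiv.swap x y).trans σ) ?_ ?_
      · intro σ hσ
        simp only [coe_filter, mem_univ, true_and, Set.mem_ofPred_eq, Equiv.trans_apply,
          Equiv.swap_apply_right] at hσ ⊢
        intro c' hc'
        apply hσ
        rw [Equiv.swap_apply_def]
        split_ifs <;> assumption
      · intro σ _ τ _ h
        ext z
        have := congrArg (fun e : X ≃ Fin n ↦ e (Equiv.swap x y z)) h
        simpa using congrArg Fin.val this
    exact fun x hx ↦ le_antisymm (key x hx c hc) (key c hc x hx)
  rw [← smul_eq_mul, ← sum_const, ← sum_congr rfl heq, ← card_biUnion]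
  · exact card_le_univ _
  · intro x hx y hy hxy
    rw [Function.onFun, disjoint_left]
    intro σ h1 h2
    simp only [mem_filter, mem_univ, true_and] at h1 h2
    exact hxy (σ.injective (le_antisymm (h1 y hy) (h2 x hx)))

open scoped Classical in
/-- The ranking in which the points of `K` precede all other points, each of the two groups being
ordered by `σ`. -/
noncomputable def priority {X : Type*} (K : Finset X) {n : ℕ} (σ : X ≃ Fin n) (x : X) : ℕ :=
  if x ∈ K then σ x else n + σ x

lemma priority_injective {X : Type*} (K : Finset X) {n : ℕ} (σ : X ≃ Fin n) :
    Function.Injective (priority K σ) := by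
  intro x y h
  have hx := (σ x).isLt
  have hy := (σ y).isLt
  apply σ.injective
  apply Fin.ext
  unfold priority at h
  split_ifs at h <;> omega

open scoped Classical in
/-- The expected number of points of `S` that come first among the points with no larger value of
`a`, provided that the ranking restricted to `S` agrees with the random order. -/
lemma sum_card_first_le {X : Type*} [Fintype X] {n : ℕ} (p : (X ≃ Fin n) → X → ℕ) (S : Finset X)
    (hp : ∀ σ, ∀ c ∈ S, ∀ c' ∈ S, p σ c ≤ p σ c' → σ c ≤ σ c') (a : X → ℝ) :
    ∑ c ∈ S, (#{σ : X ≃ Fin n | ∀ c', a c' ≤ a c → p σ c ≤ p σ c'} : ℝ)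
      ≤ Fintype.card (X ≃ Fin n) * (harmonic #S : ℝ) := by
  refine le_trans ?_ (mul_le_mul_of_nonneg_left (sum_inv_rank_le_harmonic S a)
    (Nat.cast_nonneg _))
  rw [mul_sum]
  refine sum_le_sum fun c hc ↦ ?_
  have hmem : c ∈ ({c' ∈ S | a c' ≤ a c} : Finset X) := mem_filter.2 ⟨hc, le_rfl⟩
  have hpos : 0 < (#{c' ∈ S | a c' ≤ a c} : ℝ) := by exact_mod_cast card_pos.2 ⟨c, hmem⟩
  rw [mul_one_div, le_div_iff₀ hpos, mul_comm]
  have hsub : ({σ : X ≃ Fin n | ∀ c', a c' ≤ a c → p σ c ≤ p σ c'} : Finset (X ≃ Fin n)) ⊆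
      ({σ : X ≃ Fin n | ∀ c' ∈ ({c' ∈ S | a c' ≤ a c} : Finset X), σ c ≤ σ c'} :
        Finset (X ≃ Fin n)) := by
    intro σ hσ
    simp only [mem_filter, mem_univ, true_and] at hσ ⊢
    exact fun c' hc' ↦ hp σ c hc c' hc'.1 (hσ c' hc'.2)
  have h := card_mul_card_first_le (n := n) _ hmem
  exact_mod_cast (Nat.mul_le_mul_left _ (card_le_card hsub)).trans h

section Priority

variable {X : Type*} [Fintype X] {n : ℕ} (K : Finset X)

open scoped Classical in
lemma sum_card_first_terminals_le (a : X → ℝ) :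
    ∑ c ∈ K, (#{σ : X ≃ Fin n | ∀ c', a c' ≤ a c → priority K σ c ≤ priority K σ c'} : ℝ) ≤
      Fintype.card (X ≃ Fin n) * (harmonic #K : ℝ) := by
  refine sum_card_first_le _ K (fun σ c hc c' hc' h ↦ ?_) a
  simpa [priority, hc, hc'] using h

open scoped Classical in
lemma sum_card_first_compl_le (a : X → ℝ) :
    ∑ c ∈ Kᶜ, (#{σ : X ≃ Fin n | ∀ c', a c' ≤ a c → priority K σ c ≤ priority K σ c'} : ℝ) ≤
      Fintype.card (X ≃ Fin n) * (harmonic #Kᶜ : ℝ) := by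
  refine sum_card_first_le _ Kᶜ (fun σ c hc c' hc' h ↦ ?_) a
  rw [mem_compl] at hc hc'
  simpa [priority, hc, hc'] using h

open scoped Classical in
/-- A terminal at distance zero precedes every nonterminal. -/
lemma sum_card_first_compl_eq_zero {v : X} (hv : v ∈ K) {a : X → ℝ} (hav : ∀ c, a v ≤ a c) :
    ∑ c ∈ Kᶜ, (#{σ : X ≃ Fin n | ∀ c', a c' ≤ a c → priority K σ c ≤ priority K σ c'} : ℝ) =
      0 := by
  refine sum_eq_zero fun c hc ↦ ?_
  rw [mem_compl] at hc
  rw [Nat.cast_eq_zero, card_eq_zero]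
  refine filter_eq_empty_iff.2 fun σ _ h ↦ ?_
  have h1 := h v (hav c)
  have h2 := (σ v).isLt
  simp only [priority, hc, hv, if_true, if_false] at h1
  omega

end Priority

section Metric

variable {X : Type*} [MetricSpace X]

/-- The smallest rank of a center within distance `r` of `u`. -/
noncomputable def ballKey (p : X → ℕ) (r : ℝ) (u : X) : ℕ :=
  sInf (p '' {c | dist c u ≤ r})

lemma ballKey_le (p : X → ℕ) {r : ℝ} {u c : X} (h : dist c u ≤ r) : ballKey p r u ≤ p c :=
  Nat.sInf_le ⟨c, h, rfl⟩

lemma exists_ballKey (p : X → ℕ) {r : ℝ} (hr : 0 ≤ r) (u : X) :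
    ∃ c, dist c u ≤ r ∧ p c = ballKey p r u :=
  Nat.sInf_mem (s := p '' {c | dist c u ≤ r}) ⟨p u, u, by simpa using hr, rfl⟩

lemma dist_le_of_ballKey_eq {p : X → ℕ} (hp : p.Injective) {r : ℝ} (hr : 0 ≤ r) {u w : X}
    (h : ballKey p r u = ballKey p r w) : dist u w ≤ 2 * r := by
  obtain ⟨c, hc, hcu⟩ := exists_ballKey p hr u
  obtain ⟨c', hc', hcw⟩ := exists_ballKey p hr w
  obtain rfl : c = c' := hp (by rw [hcu, hcw, h])
  linarith [dist_triangle_left u w c]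

lemma ballKey_eq_of_forall_dist_le (p : X → ℕ) {r : ℝ} (h : ∀ x y : X, dist x y ≤ r) (u w : X) :
    ballKey p r u = ballKey p r w := by
  simp [ballKey, h]

lemma ballKey_ne_of_lt {p : X → ℕ} (hp : p.Injective) {r : ℝ} (hr : 0 ≤ r)
    (h : ∀ x y : X, x ≠ y → r < dist x y) {u w : X} (huw : u ≠ w) :
    ballKey p r u ≠ ballKey p r w := by
  have key : ∀ v, ballKey p r v = p v := by
    intro v
    obtain ⟨c, hc, hcv⟩ := exists_ballKey p hr v
    by_cases hne : c = v
    · rw [← hcv, hne]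
    · exact absurd hc (h c v hne).not_ge
  rw [key, key]
  exact hp.ne huw

/-- If `u` and `w` are separated at radius `r`, then some center cuts them and precedes all centers
at least as close to the pair. -/
lemma exists_cut (p : X → ℕ) {r : ℝ} (hr : 0 ≤ r) {u w : X}
    (h : ballKey p r u ≠ ballKey p r w) :
    ∃ c, (min (dist c u) (dist c w) ≤ r ∧ r < max (dist c u) (dist c w)) ∧
      ∀ c', min (dist c' u) (dist c' w) ≤ min (dist c u) (dist c w) → p c ≤ p c' := by
  wlog hlt : ballKey p r u < ballKey p r w generalizing u w
  · obtain ⟨c, hc⟩ := this h.symm (lt_of_le_of_ne (not_lt.1 hlt) h.symm)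
    exact ⟨c, by simpa only [min_comm, max_comm] using hc⟩
  obtain ⟨c, hc, hcu⟩ := exists_ballKey p hr u
  have hcw : r < dist c w := by
    by_contra! hcw
    have := ballKey_le p hcw
    omega
  refine ⟨c, ⟨min_le_of_left_le hc, lt_max_of_lt_right hcw⟩, fun c' hc' ↦ ?_⟩
  rw [hcu]
  rcases min_le_iff.1 (hc'.trans (min_le_of_left_le hc)) with h' | h'
  · exact ballKey_le p h'
  · exact hlt.le.trans (ballKey_le p h')

lemma max_sub_min_dist_le (c u w : X) :
    max (dist c u) (dist c w) - min (dist c u) (dist c w) ≤ dist u w := by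
  rw [max_sub_min_eq_abs, abs_le]
  constructor
  · linarith [dist_triangle c w u, dist_comm w u]
  · linarith [dist_triangle c u w]

open scoped Classical in
/-- The sum over all scales of the separation counts, bounded by the number of times a center comes
first among the centers closest to the pair. -/
lemma sum_increments_mul_card_separated_le [Fintype X] {Ω : Type*} [Fintype Ω] (p : Ω → X → ℕ)
    {r : ℕ → ℝ} (hr : Monotone r) (hr0 : ∀ m, 0 ≤ r m) {ε : ℝ} {u w : X} (hε : 0 ≤ ε)
    (hεd : ε ≤ dist u w)
    (hstep : ∀ (x y : X) m, r m < dist x y → r (m + 1) - r m ≤ ε) (N : ℕ) :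
    ∑ m ∈ range N, (r (m + 1) - r m) *
        (#{σ : Ω | ballKey (p σ) (r m) u ≠ ballKey (p σ) (r m) w} : ℝ)
      ≤ 2 * dist u w * ∑ c : X, (#{σ : Ω | ∀ c',
        min (dist c' u) (dist c' w) ≤ min (dist c u) (dist c w) → p σ c ≤ p σ c'} : ℝ) := by
  set F : X → Finset Ω := fun c ↦ {σ : Ω | ∀ c',
    min (dist c' u) (dist c' w) ≤ min (dist c u) (dist c w) → p σ c ≤ p σ c'} with hF
  have hcard : ∀ m, (#{σ : Ω | ballKey (p σ) (r m) u ≠ ballKey (p σ) (r m) w} : ℝ) ≤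
      ∑ c : X, if min (dist c u) (dist c w) ≤ r m ∧ r m < max (dist c u) (dist c w)
        then (#(F c) : ℝ) else 0 := by
    intro m
    rw [← sum_filter]
    have hsub : ({σ : Ω | ballKey (p σ) (r m) u ≠ ballKey (p σ) (r m) w} : Finset Ω) ⊆
        ({c : X | min (dist c u) (dist c w) ≤ r m ∧ r m < max (dist c u) (dist c w)} :
          Finset X).biUnion F := by
      intro σ hσ
      obtain ⟨c, hc, hc'⟩ := exists_cut (p σ) (hr0 m) (mem_filter.1 hσ).2
      exact mem_biUnion.2 ⟨c, mem_filter.2 ⟨mem_univ _, hc⟩, mem_filter.2 ⟨mem_univ _, hc'⟩⟩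
    exact_mod_cast (card_le_card hsub).trans card_biUnion_le
  calc ∑ m ∈ range N, (r (m + 1) - r m) *
        (#{σ : Ω | ballKey (p σ) (r m) u ≠ ballKey (p σ) (r m) w} : ℝ)
      ≤ ∑ m ∈ range N, (r (m + 1) - r m) *
        ∑ c : X, (if min (dist c u) (dist c w) ≤ r m ∧ r m < max (dist c u) (dist c w)
          then (#(F c) : ℝ) else 0) :=
        sum_le_sum fun m _ ↦ mul_le_mul_of_nonneg_left (hcard m)
          (sub_nonneg.2 (hr m.le_succ))
    _ = ∑ c : X, #(F c) * ∑ m ∈ range N,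
        (if min (dist c u) (dist c w) ≤ r m ∧ r m < max (dist c u) (dist c w)
          then r (m + 1) - r m else 0) := by
        simp only [mul_sum]
        rw [sum_comm]
        refine sum_congr rfl fun c _ ↦ sum_congr rfl fun m _ ↦ ?_
        split_ifs <;> ring
    _ ≤ ∑ c : X, #(F c) * (2 * dist u w) := by
        refine sum_le_sum fun c _ ↦ mul_le_mul_of_nonneg_left ?_ (Nat.cast_nonneg _)
        refine (sum_increments_le_of_le hr min_le_max hε (fun m hm ↦ ?_) N).trans ?_
        · rcases lt_max_iff.1 hm with h | h
          exacts [hstep _ _ m h, hstep _ _ m h]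
        · linarith [max_sub_min_dist_le c u w]
    _ = _ := by rw [← sum_mul, mul_comm]

end Metric

section LevelDist

variable {X : Type*} {L : ℕ} {D : ℕ → ℝ} {f : ℕ → X → ℕ}

open scoped Classical in
/-- The largest weight `D i` among the levels `i` at which the labels of `u` and `w` differ. -/
noncomputable def levelDist (L : ℕ) (D : ℕ → ℝ) (f : ℕ → X → ℕ) (u w : X) : ℝ :=
  (range (L + 1)).sup' nonempty_range_add_one fun i ↦ if f i u ≠ f i w then D i else 0

lemma levelDist_self (x : X) : levelDist L D f x x = 0 := by
  simp [levelDist]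

lemma levelDist_comm (x y : X) : levelDist L D f x y = levelDist L D f y x := by
  simp only [levelDist, ne_comm]

lemma levelDist_le_max (hD : ∀ i, 0 ≤ D i) (x y z : X) :
    levelDist L D f x z ≤ max (levelDist L D f x y) (levelDist L D f y z) := by
  classical
  refine sup'_le _ _ fun i hi ↦ ?_
  have h1 : (if f i x ≠ f i y then D i else 0) ≤ levelDist L D f x y :=
    le_sup' (fun i ↦ if f i x ≠ f i y then D i else 0) hi
  have h2 : (if f i y ≠ f i z then D i else 0) ≤ levelDist L D f y z :=
    le_sup' (fun i ↦ if f i y ≠ f i z then D i else 0) hi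
  have := hD i
  by_cases hxy : f i x = f i y
  · rw [hxy]
    exact le_max_of_le_right h2
  · rw [if_pos hxy] at h1
    refine le_max_of_le_left (le_trans ?_ h1)
    split_ifs <;> linarith

lemma le_levelDist {i : ℕ} (hi : i ≤ L) {x y : X} (h : f i x ≠ f i y) :
    D i ≤ levelDist L D f x y := by
  classical
  refine le_trans ?_ (le_sup' (fun i ↦ if f i x ≠ f i y then D i else 0)
    (mem_range.2 (Nat.lt_succ_of_le hi)))
  rw [if_pos h]

open scoped Classical in
lemma levelDist_le_sum (hD : ∀ i, 0 ≤ D i) (x y : X) :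
    levelDist L D f x y ≤ ∑ i ∈ range (L + 1), if f i x ≠ f i y then D i else 0 := by
  refine sup'_le _ _ fun i hi ↦ ?_
  refine single_le_sum (f := fun i ↦ if f i x ≠ f i y then D i else 0) (fun j _ ↦ ?_) hi
  split_ifs
  exacts [hD j, le_rfl]

end LevelDist

lemma exists_pos_le_dist (X : Type*) [MetricSpace X] [Fintype X] :
    ∃ δ : ℝ, 0 < δ ∧ ∀ x y : X, x ≠ y → δ ≤ dist x y := by
  classical
  by_cases h : ({z : X × X | z.1 ≠ z.2} : Finset (X × X)).Nonempty
  · obtain ⟨z, hz, hmin⟩ := exists_min_image _ (fun z : X × X ↦ dist z.1 z.2) h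
    exact ⟨dist z.1 z.2, dist_pos.2 (mem_filter.1 hz).2,
      fun x y hxy ↦ hmin (x, y) (mem_filter.2 ⟨mem_univ _, hxy⟩)⟩
  · refine ⟨1, one_pos, fun x y hxy ↦ (h ⟨(x, y), mem_filter.2 ⟨mem_univ _, hxy⟩⟩).elim⟩

lemma exists_forall_dist_le (X : Type*) [MetricSpace X] [Fintype X] :
    ∃ B : ℝ, 0 ≤ B ∧ ∀ x y : X, dist x y ≤ B := by
  exact ⟨Metric.diam (Set.univ : Set X), Metric.diam_nonneg, fun x y ↦
    Metric.dist_le_diam_of_mem (Set.toFinite _).isBounded (Set.mem_univ x) (Set.mem_univ y)⟩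

/-- Radii growing geometrically with ratio `1 + 1 / M`, from below the least distance up to the
diameter. `M` consecutive steps form one scale. -/
structure Scales (X : Type*) [MetricSpace X] where
  r : ℕ → ℝ
  M : ℕ
  L : ℕ
  δ : ℝ
  M_pos : 0 < M
  δ_nonneg : 0 ≤ δ
  δ_le : ∀ x y : X, x ≠ y → δ ≤ dist x y
  mono : Monotone r
  nonneg : ∀ m, 0 ≤ r m
  lt_δ : ∀ m < M, r m < δ
  eq_mul_step : ∀ m, r m = M * (r (m + 1) - r m)
  add_le : ∀ m, r (m + M) ≤ 3 * r m
  dist_le : ∀ m, L * M ≤ m → ∀ x y : X, dist x y ≤ r m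
  step_le : ∀ (x y : X) m, r m < dist x y → r (m + 1) - r m ≤ δ

lemma nonempty_scales (X : Type*) [MetricSpace X] [Fintype X] : Nonempty (Scales X) := by
  obtain ⟨δ, hδ, hδX⟩ := exists_pos_le_dist X
  obtain ⟨B, hB, hBX⟩ := exists_forall_dist_le X
  obtain ⟨M, hM⟩ := exists_nat_gt (B / δ)
  have hM0' : (0 : ℝ) < M := lt_of_le_of_lt (by positivity) hM
  have hM0 : 0 < M := by exact_mod_cast hM0'
  obtain ⟨L, hL⟩ := pow_unbounded_of_one_lt (B / (δ / 3)) (one_lt_two : (1 : ℝ) < 2)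
  set q : ℝ := 1 + 1 / M with hq
  have hq1 : 1 ≤ q := by rw [hq]; linarith [one_div_pos.2 hM0']
  have hqM3 : q ^ M < 3 := by
    have h1 : q ≤ Real.exp (1 / M) := by rw [hq, add_comm]; exact Real.add_one_le_exp _
    calc q ^ M ≤ Real.exp (1 / M) ^ M := by gcongr
      _ = Real.exp 1 := by rw [← Real.exp_nat_mul]; congr 1; field_simp
      _ < 3 := by linarith [Real.exp_one_lt_d9]
  have hqM2 : 2 ≤ q ^ M := by
    have h1 := one_add_mul_le_pow (a := 1 / (M : ℝ)) (by linarith [one_div_pos.2 hM0']) M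
    have h2 : (M : ℝ) * (1 / M) = 1 := by field_simp
    rw [hq]
    linarith
  have hstep : ∀ m, δ / 3 * q ^ m = M * (δ / 3 * q ^ (m + 1) - δ / 3 * q ^ m) := by
    intro m
    rw [pow_succ, hq]
    field_simp
    ring
  have hmono : Monotone fun m ↦ δ / 3 * q ^ m := fun m m' h ↦ by
    dsimp only
    gcongr
  refine ⟨{
    r := fun m ↦ δ / 3 * q ^ m
    M := M
    L := L
    δ := δ
    M_pos := hM0
    δ_nonneg := hδ.le
    δ_le := hδX
    mono := hmono
    nonneg := fun m ↦ by positivity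
    lt_δ := fun m hm ↦ ?_
    eq_mul_step := hstep
    add_le := fun m ↦ ?_
    dist_le := fun m hm x y ↦ ?_
    step_le := fun x y m hm ↦ ?_ }⟩
  · have : q ^ m ≤ q ^ M := pow_le_pow_right₀ hq1 hm.le
    nlinarith
  · have : 0 ≤ δ / 3 * q ^ m := by positivity
    rw [pow_add]
    nlinarith
  · refine (hBX x y).trans (le_trans ?_ (hmono hm))
    have h1 : (2 : ℝ) ^ L ≤ q ^ (L * M) := by
      rw [mul_comm, pow_mul]
      gcongr
    rw [div_lt_iff₀ (by positivity)] at hL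
    dsimp only
    nlinarith
  · have h1 := hstep m
    have h2 := hm.le.trans (hBX x y)
    rw [div_lt_iff₀ hδ] at hM
    by_contra! hcon
    nlinarith [mul_lt_mul_of_pos_left hcon hM0']

section Embedding

variable {X : Type*} [MetricSpace X] {n : ℕ} (K : Finset X) (S : Scales X)

/-- The ultrametric determined by a random order `σ` and a random offset `j`. -/
noncomputable def treeDist (σ : X ≃ Fin n) (j : Fin S.M) (u w : X) : ℝ :=
  levelDist S.L (fun i ↦ 2 * S.r (j + i * S.M + S.M))
    (fun i ↦ ballKey (priority K σ) (S.r (j + i * S.M))) u w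

lemma dist_le_treeDist (σ : X ≃ Fin n) (j : Fin S.M) (u w : X) :
    dist u w ≤ treeDist K S σ j u w := by
  rcases eq_or_ne u w with rfl | huw
  · rw [dist_self, treeDist, levelDist_self]
  have hp := priority_injective K σ
  by_contra! hlt
  have hsep : ∀ i ≤ S.L, ballKey (priority K σ) (S.r (j + i * S.M)) u ≠
      ballKey (priority K σ) (S.r (j + i * S.M)) w := by
    intro i
    induction i with
    | zero =>
      intro _
      refine ballKey_ne_of_lt hp (S.nonneg _) (fun x y hxy ↦ ?_) huw
      refine lt_of_lt_of_le (S.lt_δ _ ?_) (S.δ_le x y hxy)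
      simp
    | succ i ih =>
      intro hi heq
      have h1 := dist_le_of_ballKey_eq hp (S.nonneg _) heq
      have h2 : 2 * S.r (j + i * S.M + S.M) ≤ treeDist K S σ j u w :=
        le_levelDist (D := fun i ↦ 2 * S.r (j + i * S.M + S.M)) (by omega) (ih (by omega))
      rw [Nat.succ_mul, ← add_assoc] at h1
      linarith
  exact hsep S.L le_rfl (ballKey_eq_of_forall_dist_le _ (S.dist_le _ (by omega)) u w)

variable [Fintype X]

open scoped Classical in
lemma sum_treeDist_le_sum_increments (u w : X) :
    ∑ σ : X ≃ Fin n, ∑ j : Fin S.M, treeDist K S σ j u w ≤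
      6 * S.M * ∑ m ∈ range ((S.L + 1) * S.M), (S.r (m + 1) - S.r m) *
        (#{σ : X ≃ Fin n | ballKey (priority K σ) (S.r m) u ≠
          ballKey (priority K σ) (S.r m) w} : ℝ) := by
  set g : (X ≃ Fin n) → ℕ → ℝ := fun σ m ↦ 6 * S.M * ((S.r (m + 1) - S.r m) *
    if ballKey (priority K σ) (S.r m) u ≠ ballKey (priority K σ) (S.r m) w then 1 else 0) with hg
  calc ∑ σ : X ≃ Fin n, ∑ j : Fin S.M, treeDist K S σ j u w
      ≤ ∑ σ : X ≃ Fin n, ∑ j : Fin S.M, ∑ i ∈ range (S.L + 1), g σ (j + i * S.M) := by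
        refine sum_le_sum fun σ _ ↦ sum_le_sum fun j _ ↦ ?_
        refine (levelDist_le_sum (fun i ↦ mul_nonneg zero_le_two (S.nonneg _)) u w).trans ?_
        refine sum_le_sum fun i _ ↦ ?_
        rw [hg]
        dsimp only
        split_ifs
        · linarith [S.add_le (j + i * S.M), S.eq_mul_step (j + i * S.M)]
        · simp
    _ = ∑ σ : X ≃ Fin n, ∑ m ∈ range ((S.L + 1) * S.M), g σ m := by
        refine sum_congr rfl fun σ _ ↦ ?_
        rw [sum_comm, ← sum_range_mul_eq]
        exact sum_congr rfl fun i _ ↦ Fin.sum_univ_eq_sum_range (fun j ↦ g σ (j + i * S.M)) S.M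
    _ = _ := by
        rw [sum_comm, mul_sum]
        refine sum_congr rfl fun m _ ↦ ?_
        rw [hg, ← mul_sum, ← mul_sum, sum_boole]

open scoped Classical in
lemma sum_treeDist_le {u w : X} {h : ℝ}
    (hh : ∑ c : X, (#{σ : X ≃ Fin n | ∀ c', min (dist c' u) (dist c' w) ≤
      min (dist c u) (dist c w) → priority K σ c ≤ priority K σ c'} : ℝ) ≤
        Fintype.card (X ≃ Fin n) * h) :
    ∑ σ : X ≃ Fin n, ∑ j : Fin S.M, treeDist K S σ j u w ≤
      Fintype.card (X ≃ Fin n) * S.M * (12 * h * dist u w) := by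
  rcases eq_or_ne u w with rfl | huw
  · simp [treeDist, levelDist_self]
  refine (sum_treeDist_le_sum_increments K S u w).trans ?_
  have h1 := sum_increments_mul_card_separated_le (fun σ : X ≃ Fin n ↦ priority K σ) S.mono
    S.nonneg S.δ_nonneg (S.δ_le u w huw) S.step_le ((S.L + 1) * S.M)
  have h2 := mul_le_mul_of_nonneg_left hh (mul_nonneg zero_le_two (dist_nonneg (x := u) (y := w)))
  refine (mul_le_mul_of_nonneg_left (h1.trans h2) (by positivity)).trans_eq ?_
  ring

end Embedding

lemma harmonic_le_three_mul_log {m n : ℕ} (hmn : m ≤ n) (hn : 2 ≤ n) :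
    (harmonic m : ℝ) ≤ 3 * Real.log n := by
  have h1 : (harmonic m : ℝ) ≤ harmonic n := by
    unfold harmonic
    push_cast
    exact sum_le_sum_of_subset_of_nonneg (range_subset_range.2 hmn) fun _ _ _ ↦ by positivity
  have h2 := harmonic_le_one_add_log n
  have h3 : Real.log 2 ≤ Real.log n := Real.log_le_log two_pos (by exact_mod_cast hn)
  linarith [Real.log_two_gt_d9]

end StrongTerminal

open StrongTerminal in
/-- Probabilistic embedding into ultrametrics with strong terminal distortion
`(O(log k), O(log n))`: for every finite metric space on `n ≥ 2` points with `k ≥ 2`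
terminals there is a finitely supported distribution over dominating ultrametrics whose
expected distance is at most `C·log k` times the metric distance for pairs containing a
terminal, and at most `C·log n` times the metric distance for all pairs. -/
theorem probabilistic_ultrametric_strong_terminal :
    ∃ C : ℝ, 0 < C ∧
      ∀ (X : Type) [MetricSpace X] [Fintype X] (K : Finset X),
        2 ≤ Fintype.card X → 2 ≤ K.card →
        ∃ (N : ℕ) (prob : Fin N → ℝ) (ρ : Fin N → X → X → ℝ),
          (∀ i, 0 ≤ prob i) ∧ (∑ i, prob i) = 1 ∧
          (∀ i, prob i ≠ 0 →
            (∀ x, ρ i x x = 0) ∧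
            (∀ x y, ρ i x y = ρ i y x) ∧
            (∀ x y z, ρ i x z ≤ max (ρ i x y) (ρ i y z)) ∧
            (∀ x y, dist x y ≤ ρ i x y)) ∧
          (∀ v ∈ K, ∀ u : X,
            (∑ i, prob i * ρ i v u) ≤ C * Real.log K.card * dist v u) ∧
          (∀ u w : X,
            (∑ i, prob i * ρ i u w) ≤ C * Real.log (Fintype.card X) * dist u w) := by
  classical
  refine ⟨72, by norm_num, fun X _ _ K hX hK ↦ ?_⟩
  obtain ⟨S⟩ := nonempty_scales X
  let Ω := (X ≃ Fin (Fintype.card X)) × Fin S.M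
  let e := (Fintype.equivFin Ω).symm
  have : Nonempty (X ≃ Fin (Fintype.card X)) := ⟨Fintype.equivFin X⟩
  have hT : (0 : ℝ) < Fintype.card (X ≃ Fin (Fintype.card X)) * S.M :=
    mul_pos (by exact_mod_cast Fintype.card_pos) (by exact_mod_cast S.M_pos)
  have hcard : (Fintype.card Ω : ℝ) = Fintype.card (X ≃ Fin (Fintype.card X)) * S.M := by
    rw [Fintype.card_prod, Fintype.card_fin, Nat.cast_mul]
  have hexp : ∀ (u w : X) (h : ℝ),
      ∑ c : X, (#{σ : X ≃ Fin (Fintype.card X) | ∀ c', min (dist c' u) (dist c' w) ≤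
        min (dist c u) (dist c w) → priority K σ c ≤ priority K σ c'} : ℝ) ≤
          Fintype.card (X ≃ Fin (Fintype.card X)) * h →
      ∑ i, 1 / (Fintype.card Ω : ℝ) * treeDist K S (e i).1 (e i).2 u w ≤
        12 * h * dist u w := by
    intro u w h hh
    rw [← mul_sum, e.sum_comp fun z : Ω ↦ treeDist K S z.1 z.2 u w, Fintype.sum_prod_type,
      one_div_mul_eq_div, hcard, div_le_iff₀ hT, mul_comm]
    exact sum_treeDist_le K S hh
  have hsplit : ∀ u w : X, _ := fun u w ↦ sum_add_sum_compl K fun c ↦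
    (#{σ : X ≃ Fin (Fintype.card X) | ∀ c', min (dist c' u) (dist c' w) ≤
      min (dist c u) (dist c w) → priority K σ c ≤ priority K σ c'} : ℝ)
  have hlogX : 0 ≤ Real.log (Fintype.card X) := Real.log_natCast_nonneg _
  have hlogK : 0 ≤ Real.log K.card := Real.log_natCast_nonneg _
  refine ⟨Fintype.card Ω, fun _ ↦ 1 / Fintype.card Ω, fun i ↦ treeDist K S (e i).1 (e i).2,
    fun _ ↦ by positivity, ?_, fun i _ ↦ ⟨fun x ↦ levelDist_self x,
      fun x y ↦ levelDist_comm x y,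
      fun x y z ↦ levelDist_le_max (fun _ ↦ mul_nonneg zero_le_two (S.nonneg _)) x y z,
      fun x y ↦ dist_le_treeDist K S _ _ x y⟩, fun v hv u ↦ ?_, fun u w ↦ ?_⟩
  · rw [sum_const, card_univ, Fintype.card_fin, nsmul_eq_mul, mul_one_div_cancel]
    rw [hcard]
    exact hT.ne'
  · refine (hexp v u (harmonic #K) ?_).trans ?_
    · rw [← hsplit, sum_card_first_compl_eq_zero K hv fun c ↦ ?_, add_zero]
      · exact sum_card_first_terminals_le K _
      · rw [dist_self, min_eq_left dist_nonneg]
        exact le_min dist_nonneg dist_nonneg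
    · refine mul_le_mul_of_nonneg_right ?_ dist_nonneg
      linarith [harmonic_le_three_mul_log le_rfl hK]
  · refine (hexp u w (harmonic #K + harmonic #Kᶜ) ?_).trans ?_
    · rw [← hsplit, mul_add]
      exact add_le_add (sum_card_first_terminals_le K _) (sum_card_first_compl_le K _)
    · refine mul_le_mul_of_nonneg_right ?_ dist_nonneg
      linarith [harmonic_le_three_mul_log (card_le_univ K) hX,
        harmonic_le_three_mul_log (card_le_univ Kᶜ) hX]
end

section
/- Let V be a finite vertex set, let G be a simple graph on V with a capacity c(e) ≥ 0 assigned to each edge e of G, and let T be a simple graph on V that is a tree (connected and acyclic), not necessarily a subgraph of G. For a tree edge e' of T with endpoints a and b, let S_{T,e'} ⊆ V be the vertex set of the connected component of a in T with the edge e' deleted, and define C_T(e') = Σ c(e) over all edges e of G with exactly one endpoint in S_{T,e'}. Suppose further that for each tree edge e' with endpoints a,b, a walk P(e') in G from a to b is given, and define load(e) = Σ C_T(e') over all tree edges e' such that e is an edge of the walk P(e'). Then for every subset S ⊆ V: Σ_{e ∈ E_G(S,S̄)} c(e) ≤ Σ_{e' ∈ E_T(S,S̄)} C_T(e') ≤ Σ_{e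 ∈ E_G(S,S̄)} load(e), where for a graph H, E_H(S,S̄) denotes the set of edges of H with exactly one endpoint in S. -/
/-- `crosses S e` means the unordered pair `e` has exactly one endpoint in `S`. -/
def crosses {V : Type} (S : Set V) (e : Sym2 V) : Prop :=
  ∃ x y, e = s(x, y) ∧ x ∈ S ∧ y ∉ S

open SimpleGraph in
/-- After deleting the edge `s(a, b)` from a connected graph, every vertex is still joined to
`a` or to `b`. -/
theorem SimpleGraph.Connected.reachable_deleteEdges_or {V : Type*} {T : SimpleGraph V}
    (hT : T.Connected) (a b v : V) :
    (T.deleteEdges {s(a, b)}).Reachable a v ∨ (T.deleteEdges {s(a, b)}).Reachable b v := by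
  have hstep : ∀ u w, T.Adj u w →
      (T.deleteEdges {s(a, b)}).Reachable a u ∨ (T.deleteEdges {s(a, b)}).Reachable b u →
      (T.deleteEdges {s(a, b)}).Reachable a w ∨ (T.deleteEdges {s(a, b)}).Reachable b w := by
    intro u w h ih
    by_cases he : s(u, w) = s(a, b)
    · rcases Sym2.eq_iff.1 he with ⟨-, rfl⟩ | ⟨-, rfl⟩
      · exact Or.inr (Reachable.refl _)
      · exact Or.inl (Reachable.refl _)
    · have hadj : (T.deleteEdges {s(a, b)}).Adj u w := deleteEdges_adj.2 ⟨h, he⟩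
      exact ih.imp (·.trans hadj.reachable) (·.trans hadj.reachable)
  have hwalk : ∀ u w, T.Walk u w →
      (T.deleteEdges {s(a, b)}).Reachable a u ∨ (T.deleteEdges {s(a, b)}).Reachable b u →
      (T.deleteEdges {s(a, b)}).Reachable a w ∨ (T.deleteEdges {s(a, b)}).Reachable b w := by
    intro u w p
    induction p with
    | nil => exact id
    | cons h _ ih => exact fun hu => ih (hstep _ _ h hu)
  obtain ⟨p⟩ := hT.preconnected a v
  exact hwalk a v p (Or.inl (Reachable.refl _))

open SimpleGraph in
/-- In an acyclic graph, deleting an edge of a path separates the ends of the path. -/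
theorem SimpleGraph.IsAcyclic.not_reachable_deleteEdges {V : Type*} {T : SimpleGraph V}
    (hT : T.IsAcyclic) {x y : V} {p : T.Walk x y} (hp : p.IsPath) {e : Sym2 V}
    (he : e ∈ p.edges) : ¬ (T.deleteEdges {e}).Reachable x y := by
  classical
  rintro ⟨q⟩
  have hle : T.deleteEdges {e} ≤ T := deleteEdges_le _
  have hpq : p = (q.toPath : (T.deleteEdges {e}).Walk x y).mapLe hle :=
    congrArg Subtype.val ((hT.subsingleton_path x y).elim ⟨p, hp⟩ ⟨_, q.toPath.2.mapLe hle⟩)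
  rw [hpq, Walk.edges_mapLe_eq_edges] at he
  have := Walk.edges_subset_edgeSet _ he
  simp at this

/-- A walk that leaves `S` has an edge with exactly one endpoint in `S`. -/
theorem SimpleGraph.Walk.exists_crosses {V : Type} {H : SimpleGraph V} {x y : V}
    (p : H.Walk x y) {S : Set V} (hx : x ∈ S) (hy : y ∉ S) : ∃ e ∈ p.edges, crosses S e := by
  obtain ⟨d, hd, h₁, h₂⟩ := p.exists_boundary_dart S hx hy
  exact ⟨d.edge, List.mem_map_of_mem hd, d.fst, d.snd, rfl, h₁, h₂⟩

/-- A walk between the two endpoints of an edge crossing `S` has an edge crossing `S`. -/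
theorem crosses.exists_mem_edges {V : Type} {H : SimpleGraph V} {a b : V} {S : Set V}
    (h : crosses S s(a, b)) (p : H.Walk a b) : ∃ e ∈ p.edges, crosses S e := by
  obtain ⟨x, y, hxy, hx, hy⟩ := h
  rcases Sym2.eq_iff.1 hxy with ⟨rfl, rfl⟩ | ⟨rfl, rfl⟩
  · exact p.exists_crosses hx hy
  · obtain ⟨e, he, hS⟩ := p.reverse.exists_crosses hx hy
    exact ⟨e, by simpa using he, hS⟩

/-- If deleting `s(a, b)` from a connected graph separates `x` from `y`, then `s(x, y)` crosses
the component of `a`. -/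
theorem SimpleGraph.Connected.crosses_component {V : Type} {T : SimpleGraph V}
    (hT : T.Connected) {a b x y : V} (h : ¬ (T.deleteEdges {s(a, b)}).Reachable x y) :
    crosses {v | (T.deleteEdges {s(a, b)}).Reachable a v} s(x, y) := by
  by_cases hx : (T.deleteEdges {s(a, b)}).Reachable a x
  · exact ⟨x, y, rfl, hx, fun hy => h (hx.symm.trans hy)⟩
  · have hbx := (hT.reachable_deleteEdges_or a b x).resolve_left hx
    refine ⟨y, x, Sym2.eq_swap, ?_, hx⟩
    exact (hT.reachable_deleteEdges_or a b y).resolve_right fun hy => h (hbx.symm.trans hy)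

/-- A weighted covering inequality: if every element of `s` is related to some element of `t`,
then the weight of `s` is at most the sum over `t` of the weights of the related elements. -/
theorem finsum_mem_le_finsum_mem_of_cover {α β : Type*} [Finite α] [Finite β]
    {s u : Set α} {t : Set β} {R : α → β → Prop} {f : α → ℝ} (hf : ∀ a ∈ u, 0 ≤ f a)
    (hsu : s ⊆ u) (hR : ∀ a ∈ s, ∃ b ∈ t, R a b) :
    ∑ᶠ a ∈ s, f a ≤ ∑ᶠ b ∈ t, ∑ᶠ a ∈ {a | a ∈ u ∧ R a b}, f a := by
  classical
  cases nonempty_fintype α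
  cases nonempty_fintype β
  simp only [finsum_mem_eq_toFinset_sum]
  rw [Finset.sum_comm' (t' := u.toFinset) (s' := fun a => t.toFinset.filter (R a))
    (by intro b a; simp only [Set.mem_toFinset, Set.mem_ofPred_eq, Finset.mem_filter]; tauto)]
  refine (Finset.sum_le_sum fun a ha => ?_).trans
    (Finset.sum_le_sum_of_subset_of_nonneg (Set.toFinset_subset_toFinset.2 hsu) fun a ha _ =>
      Finset.sum_nonneg fun _ _ => hf a (Set.mem_toFinset.1 ha))
  have ha := Set.mem_toFinset.1 ha
  obtain ⟨b, hb, hab⟩ := hR a ha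
  exact Finset.single_le_sum (f := fun _ => f a) (fun _ _ => hf a (hsu ha))
    (Finset.mem_filter.2 ⟨Set.mem_toFinset.2 hb, hab⟩)

/-- The cut-capacity lemma for capacity-dominating trees: let `G` be a graph on a finite
vertex set with nonnegative edge capacities `c`, let `T` be a tree on the same vertex set,
let `CT e'` be the total `G`-capacity crossing the component `S_{T,e'}` obtained by
deleting the tree edge `e'` (with a designated endpoint `a`), let each tree edge `e'`
carry a walk `P(e')` in `G` between its endpoints (membership of a graph edge in this
walk is recorded by `inWalk`), and let `load e = Σ_{e' : e ∈ P(e')} CT e'`. Then for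
every cut `S ⊆ V`,
`Σ_{e ∈ E_G(S,S̄)} c e ≤ Σ_{e' ∈ E_T(S,S̄)} CT e' ≤ Σ_{e ∈ E_G(S,S̄)} load e`. -/
theorem tree_cut_capacity_sandwich {V : Type} [Fintype V]
    (G : SimpleGraph V) (c : Sym2 V → ℝ) (hc : ∀ e ∈ G.edgeSet, 0 ≤ c e)
    (T : SimpleGraph V) (hT : T.IsTree)
    (CT : Sym2 V → ℝ) (inWalk : Sym2 V → Sym2 V → Prop) (load : Sym2 V → ℝ)
    (hdata : ∀ e' ∈ T.edgeSet, ∃ (a b : V) (_ : T.Adj a b) (p : G.Walk a b),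
      e' = s(a, b) ∧
      CT e' = (∑ᶠ e ∈ {e | e ∈ G.edgeSet ∧
        crosses {v | (T.deleteEdges {e'}).Reachable a v} e}, c e) ∧
      (∀ e : Sym2 V, inWalk e e' ↔ e ∈ p.edges))
    (hload : ∀ e : Sym2 V,
      load e = ∑ᶠ e' ∈ {e' | e' ∈ T.edgeSet ∧ inWalk e e'}, CT e') :
    ∀ S : Set V,
      (∑ᶠ e ∈ {e | e ∈ G.edgeSet ∧ crosses S e}, c e) ≤
        (∑ᶠ e' ∈ {e' | e' ∈ T.edgeSet ∧ crosses S e'}, CT e') ∧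
      (∑ᶠ e' ∈ {e' | e' ∈ T.edgeSet ∧ crosses S e'}, CT e') ≤
        ∑ᶠ e ∈ {e | e ∈ G.edgeSet ∧ crosses S e}, load e := by
  have hCT : ∀ e' ∈ T.edgeSet, 0 ≤ CT e' := by
    intro e' he'
    obtain ⟨a, b, -, p, -, h, -⟩ := hdata e' he'
    rw [h]
    exact finsum_nonneg fun e => finsum_nonneg fun he => hc e he.1
  intro S
  constructor
  · have := hT.connected.nonempty
    choose! r hr using fun e' he' =>
      let ⟨a, b, _, _, h₁, h₂, _⟩ := hdata e' he'
      (⟨a, ⟨b, h₁⟩, h₂⟩ : ∃ a, (∃ b, e' = s(a, b)) ∧ CT e' = ∑ᶠ e ∈ {e | e ∈ G.edgeSet ∧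
        crosses {v | (T.deleteEdges {e'}).Reachable a v} e}, c e)
    rw [finsum_mem_congr rfl fun e' he' => (hr e' he'.1).2]
    refine finsum_mem_le_finsum_mem_of_cover hc (fun e he => he.1) ?_
    rintro e ⟨-, x, y, rfl, hx, hy⟩
    obtain ⟨q, hq, -⟩ := hT.existsUnique_path x y
    obtain ⟨e', he', hS⟩ := q.exists_crosses hx hy
    have heT := q.edges_subset_edgeSet he'
    refine ⟨e', ⟨heT, hS⟩, ?_⟩
    have hsep := hT.isAcyclic.not_reachable_deleteEdges hq he'
    obtain ⟨b, hb⟩ := (hr e' heT).1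
    generalize r e' = a at hb ⊢
    subst hb
    exact hT.connected.crosses_component hsep
  · simp only [hload]
    refine finsum_mem_le_finsum_mem_of_cover hCT (fun e he => he.1) ?_
    rintro e' ⟨he', hS⟩
    obtain ⟨a, b, -, p, rfl, -, hwalk⟩ := hdata e' he'
    obtain ⟨e, he, heS⟩ := hS.exists_mem_edges p
    exact ⟨e, ⟨p.edges_subset_edgeSet he, heS⟩, (hwalk e).2 he⟩
end

section
/- There exists a universal constant C > 0 such that the following holds. Let G be a connected simple graph on a finite vertex set V with |V| = n ≥ 16, with a weight function w assigning a positive real to each edge, and let K ⊆ V be a set of terminals with |K| = k ≥ 16. Then there exists a finitely supported probability distribution μ over spanning trees of G (subgraphs of G on the full vertex set that are connected and acyclic) such that: (a) for every v ∈ K and u ∈ V, E_{T∼μ}[d_{T,w}(v,u)] ≤ C·(log k)·(log log k)·(log log log k)·d_{G,w}(v,u); and (b) for every u,x ∈ V, E_{T∼μ}[d_{T,w}(u,x)] ≤ C·(log n)·(log log n)·(log log log n)·d_{G,w}(u,x). Here log denotes the natural logarithm. -/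
/-- The weighted shortest-path distance in a graph `G` with edge weights `w`:
the infimum of the weighted lengths of walks from `u` to `v`. -/
noncomputable def wdist {V : Type} (G : SimpleGraph V) (w : Sym2 V → ℝ) (u v : V) : ℝ :=
  sInf {L : ℝ | ∃ p : G.Walk u v, L = (p.edges.map w).sum}

/-! ### Weighted lengths of walks -/

/-- The graph `T` contains a walk from `u` to `v` of weighted length at most `L`. -/
def JoinedWithin {V : Type} (T : SimpleGraph V) (w : Sym2 V → ℝ) (u v : V) (L : ℝ) : Prop :=
  ∃ p : T.Walk u v, (p.edges.map w).sum ≤ L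

section Walks

variable {V : Type} {T T' : SimpleGraph V} {w : Sym2 V → ℝ} {a b c : V} {L L' : ℝ}

theorem JoinedWithin.refl (T : SimpleGraph V) (w : Sym2 V → ℝ) (a : V) (hL : 0 ≤ L) :
    JoinedWithin T w a a L :=
  ⟨SimpleGraph.Walk.nil, by simpa using hL⟩

theorem JoinedWithin.of_adj (h : T.Adj a b) : JoinedWithin T w a b (w s(a, b)) :=
  ⟨h.toWalk, by simp⟩

theorem JoinedWithin.trans (h : JoinedWithin T w a b L) (h' : JoinedWithin T w b c L') :
    JoinedWithin T w a c (L + L') := by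
  obtain ⟨p, hp⟩ := h
  obtain ⟨q, hq⟩ := h'
  exact ⟨p.append q, by simpa [SimpleGraph.Walk.edges_append] using add_le_add hp hq⟩

theorem JoinedWithin.symm (h : JoinedWithin T w a b L) : JoinedWithin T w b a L := by
  obtain ⟨p, hp⟩ := h
  exact ⟨p.reverse, by simpa [SimpleGraph.Walk.edges_reverse, List.sum_reverse] using hp⟩

theorem JoinedWithin.mono (h : JoinedWithin T w a b L) (hT : T ≤ T') (hL : L ≤ L') :
    JoinedWithin T' w a b L' := by
  obtain ⟨p, hp⟩ := h
  exact ⟨p.mapLe hT, by simpa using hp.trans hL⟩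

theorem JoinedWithin.reachable (h : JoinedWithin T w a b L) : T.Reachable a b :=
  ⟨h.choose⟩

theorem walk_sum_nonneg (hw : ∀ e ∈ T.edgeSet, 0 ≤ w e) (p : T.Walk a b) :
    0 ≤ (p.edges.map w).sum := by
  refine List.sum_nonneg fun x hx => ?_
  obtain ⟨e, he, rfl⟩ := List.mem_map.1 hx
  exact hw e (p.edges_subset_edgeSet he)

theorem bddBelow_walk_sums (hw : ∀ e ∈ T.edgeSet, 0 ≤ w e) (a b : V) :
    BddBelow {L : ℝ | ∃ p : T.Walk a b, L = (p.edges.map w).sum} :=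
  ⟨0, by rintro _ ⟨p, rfl⟩; exact walk_sum_nonneg hw p⟩

theorem JoinedWithin.wdist_le (hw : ∀ e ∈ T.edgeSet, 0 ≤ w e) (h : JoinedWithin T w a b L) :
    wdist T w a b ≤ L := by
  obtain ⟨p, hp⟩ := h
  exact (csInf_le (bddBelow_walk_sums hw a b) ⟨p, rfl⟩).trans hp

theorem wdist_nonneg (hw : ∀ e ∈ T.edgeSet, 0 ≤ w e) (a b : V) : 0 ≤ wdist T w a b :=
  Real.sInf_nonneg (by rintro _ ⟨p, rfl⟩; exact walk_sum_nonneg hw p)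

theorem wdist_anti (hw : ∀ e ∈ T'.edgeSet, 0 ≤ w e) (hT : T ≤ T') (h : T.Reachable a b) :
    wdist T' w a b ≤ wdist T w a b := by
  refine csInf_le_csInf (bddBelow_walk_sums hw a b) ?_ ?_
  · exact ⟨_, h.some, rfl⟩
  · rintro _ ⟨p, rfl⟩
    exact ⟨p.mapLe hT, by simp⟩

theorem wdist_self (hw : ∀ e ∈ T.edgeSet, 0 ≤ w e) (a : V) : wdist T w a a = 0 :=
  le_antisymm ((JoinedWithin.refl T w a le_rfl).wdist_le hw) (wdist_nonneg hw a a)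

/-- A function whose variation along edges is at most `κ` times the weight varies by at most
`κ` times the length along a walk. -/
theorem abs_sub_le_mul_walk_sum {X : Set V} {f : V → ℝ} {κ : ℝ} (hκ : 0 ≤ κ)
    (hw : ∀ e ∈ T.edgeSet, 0 ≤ w e)
    (hf : ∀ a ∈ X, ∀ b ∈ X, T.Adj a b → |f a - f b| ≤ κ * w s(a, b))
    {u v : V} (p : T.Walk u v) (hp : ∀ x ∈ p.support, x ∈ X) {x : V} (hx : x ∈ p.support) :
    |f u - f x| ≤ κ * (p.edges.map w).sum := by
  induction p with
  | nil => simp_all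
  | @cons u c v h q ih =>
    have h0 : 0 ≤ κ * (q.edges.map w).sum := mul_nonneg hκ (walk_sum_nonneg hw q)
    have h1 : 0 ≤ κ * w s(u, c) := mul_nonneg hκ (hw _ h)
    simp only [SimpleGraph.Walk.edges_cons, List.map_cons, List.sum_cons, mul_add]
    rw [SimpleGraph.Walk.support_cons, List.mem_cons] at hx
    rcases hx with rfl | hx
    · simpa using add_nonneg h1 h0
    · have h2 := ih (fun y hy => hp y (by simp [hy])) hx
      have h3 := hf u (hp u (by simp)) c (hp c (by simp)) h
      calc |f u - f x| ≤ |f u - f c| + |f c - f x| := abs_sub_le _ _ _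
        _ ≤ _ := add_le_add h3 h2

end Walks

/-! ### Distance potentials -/

/-- `F` is the distance function on the cluster `X` with edge weights `w`, measured from the
sources `S` with initial values `h`: it satisfies the triangle inequality along edges and every
value is attained either at a source or through a neighbour. -/
structure IsPotential {V : Type} (G : SimpleGraph V) (X : Finset V) (w : Sym2 V → ℝ)
    (S : Set V) (h F : V → ℝ) : Prop where
  le_source : ∀ s ∈ S, s ∈ X → F s ≤ h s
  lipschitz : ∀ a ∈ X, ∀ b ∈ X, G.Adj a b → F b ≤ F a + w s(a, b)
  tight : ∀ v ∈ X, (v ∈ S ∧ F v = h v) ∨ ∃ a ∈ X, G.Adj a v ∧ F v = F a + w s(a, v)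

section Potentials

variable {V : Type} {G : SimpleGraph V} {X : Finset V} {w : Sym2 V → ℝ} {S : Set V}
  {h F : V → ℝ}

/-- Induction along a strictly decreasing rank function on a finite set. -/
theorem Finset.induction_of_rank {X : Finset V} (rank : V → ℝ) {P : V → Prop}
    (step : ∀ v ∈ X, (∀ a ∈ X, rank a < rank v → P a) → P v) : ∀ v ∈ X, P v := by
  by_contra! hcon
  obtain ⟨v, hv, hPv⟩ := hcon
  classical
  obtain ⟨m, hm, hmin⟩ := (X.filter fun v => ¬ P v).exists_min_image rank
    ⟨v, Finset.mem_filter.2 ⟨hv, hPv⟩⟩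
  rw [Finset.mem_filter] at hm
  refine hm.2 (step m hm.1 fun a ha hlt => ?_)
  by_contra hPa
  exact absurd (hmin a (Finset.mem_filter.2 ⟨ha, hPa⟩)) (not_le.2 hlt)

theorem IsPotential.induction (hF : IsPotential G X w S h F)
    (hw : ∀ a ∈ X, ∀ b ∈ X, G.Adj a b → 0 < w s(a, b)) {P : V → Prop}
    (source : ∀ v ∈ X, v ∈ S → F v = h v → P v)
    (step : ∀ a ∈ X, ∀ v ∈ X, G.Adj a v → F v = F a + w s(a, v) → P a → P v) :
    ∀ v ∈ X, P v := by
  refine Finset.induction_of_rank F fun v hv ih => ?_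
  rcases hF.tight v hv with ⟨hS, hh⟩ | ⟨a, ha, hadj, he⟩
  · exact source v hv hS hh
  · exact step a ha v hv hadj he (ih a ha (by linarith [hw a ha v hv hadj]))

/-- A potential exists as soon as every vertex can be reached from a source. -/
theorem exists_isPotential (G : SimpleGraph V) (X : Finset V) (w : Sym2 V → ℝ) (S : Set V)
    (h : V → ℝ) (hw : ∀ a ∈ X, ∀ b ∈ X, G.Adj a b → 0 ≤ w s(a, b)) (rank : V → ℝ)
    (hrank : ∀ v ∈ X, v ∈ S ∨ ∃ a ∈ X, G.Adj a v ∧ rank a < rank v) :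
    ∃ F : V → ℝ, IsPotential G X w S h F := by
  classical
  set A : Set (V → ℝ) := {f | (∀ s ∈ S, s ∈ X → f s ≤ h s) ∧
    ∀ a ∈ X, ∀ b ∈ X, G.Adj a b → f b ≤ f a + w s(a, b)} with hA
  have hne : A.Nonempty := by
    obtain ⟨c, hc⟩ := (X.image h).bddBelow
    refine ⟨fun _ => c, fun s _ hs => hc (Finset.mem_coe.2 (Finset.mem_image_of_mem h hs)), ?_⟩
    intro a ha b hb hab
    simpa using hw a ha b hb hab
  have hbdd : ∀ v ∈ X, BddAbove ((fun f : V → ℝ => f v) '' A) := by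
    refine Finset.induction_of_rank rank fun v hv ih => ?_
    rcases hrank v hv with hS | ⟨a, ha, hadj, hlt⟩
    · exact ⟨h v, by rintro _ ⟨f, hf, rfl⟩; exact hf.1 v hS hv⟩
    · obtain ⟨B, hB⟩ := ih a ha hlt
      refine ⟨B + w s(a, v), ?_⟩
      rintro _ ⟨f, hf, rfl⟩
      exact (hf.2 a ha v hv hadj).trans (by linarith [hB ⟨f, hf, rfl⟩])
  set F : V → ℝ := fun v => sSup ((fun f : V → ℝ => f v) '' A) with hFdef
  have hle : ∀ f ∈ A, ∀ v ∈ X, f v ≤ F v := fun f hf v hv => le_csSup (hbdd v hv) ⟨f, hf, rfl⟩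
  have hFA : F ∈ A := by
    refine ⟨fun s hs hsX => csSup_le (hne.image _) ?_, fun a ha b hb hab =>
      csSup_le (hne.image _) ?_⟩
    · rintro _ ⟨f, hf, rfl⟩
      exact hf.1 s hs hsX
    · rintro _ ⟨f, hf, rfl⟩
      exact (hf.2 a ha b hb hab).trans (by linarith [hle f hf a ha])
  refine ⟨F, hFA.1, hFA.2, fun v hv => ?_⟩
  by_contra! hcon
  obtain ⟨hc1, hc2⟩ := hcon
  set U : Finset ℝ := ((X.filter fun a => G.Adj a v).image fun a => F a + w s(a, v)) ∪
    (if v ∈ S then {h v} else ∅) with hU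
  have hUlt : ∀ x ∈ U, F v < x := by
    intro x hx
    rw [hU, Finset.mem_union, Finset.mem_image] at hx
    rcases hx with ⟨a, ha, rfl⟩ | hx
    · rw [Finset.mem_filter] at ha
      exact lt_of_le_of_ne (hFA.2 a ha.1 v hv ha.2) (hc2 a ha.1 ha.2)
    · split_ifs at hx with hvS
      · rw [Finset.mem_singleton] at hx
        subst hx
        exact lt_of_le_of_ne (hFA.1 v hvS hv) (hc1 hvS)
      · simp at hx
  have hUne : U.Nonempty := by
    rcases hrank v hv with hS | ⟨a, ha, hadj, _⟩
    · exact ⟨h v, by simp [hU, hS]⟩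
    · exact ⟨F a + w s(a, v), Finset.mem_union_left _
        (Finset.mem_image_of_mem _ (Finset.mem_filter.2 ⟨ha, hadj⟩))⟩
  set c := U.min' hUne with hc
  have hcF : F v < c := hUlt c (U.min'_mem hUne)
  have hcU : ∀ x ∈ U, c ≤ x := fun x hx => U.min'_le x hx
  have hup : Function.update F v c ∈ A := by
    refine ⟨fun s hs hsX => ?_, fun a ha b hb hab => ?_⟩
    · rcases eq_or_ne s v with rfl | hsv
      · rw [Function.update_self]
        exact hcU _ (by simp [hU, hs])
      · rw [Function.update_of_ne hsv]
        exact hFA.1 s hs hsX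
    · rcases eq_or_ne b v with rfl | hbv
      · rw [Function.update_self, Function.update_of_ne hab.ne]
        exact hcU _ (Finset.mem_union_left _
          (Finset.mem_image_of_mem _ (Finset.mem_filter.2 ⟨ha, hab⟩)))
      · rw [Function.update_of_ne hbv]
        have h1 := hFA.2 a ha b hb hab
        rcases eq_or_ne a v with rfl | hav
        · rw [Function.update_self]; linarith
        · rw [Function.update_of_ne hav]; exact h1
  have := hle _ hup v hv
  rw [Function.update_self] at this
  linarith

theorem IsPotential.nonneg (hF : IsPotential G X w S h F)
    (hw : ∀ a ∈ X, ∀ b ∈ X, G.Adj a b → 0 < w s(a, b)) (hh : ∀ v ∈ S, 0 ≤ h v) :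
    ∀ v ∈ X, 0 ≤ F v := by
  refine hF.induction hw (fun v _ hS hv => hv ▸ hh v hS) fun a ha v hv hadj he hPa => ?_
  rw [he]
  exact add_nonneg hPa (hw a ha v hv hadj).le

/-- The rank induced by a potential: every vertex is a source or has a closer neighbour. -/
theorem IsPotential.rank (hF : IsPotential G X w S h F)
    (hw : ∀ a ∈ X, ∀ b ∈ X, G.Adj a b → 0 < w s(a, b)) :
    ∀ v ∈ X, v ∈ S ∨ ∃ a ∈ X, G.Adj a v ∧ F a < F v := by
  intro v hv
  rcases hF.tight v hv with ⟨hS, _⟩ | ⟨a, ha, hadj, he⟩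
  · exact Or.inl hS
  · exact Or.inr ⟨a, ha, hadj, by linarith [hw a ha v hv hadj]⟩

/-- A shortest path realizing the value of a single-source potential. -/
theorem IsPotential.exists_path {x : V} (hF : IsPotential G X w {x} (fun _ => 0) F)
    (hw : ∀ a ∈ X, ∀ b ∈ X, G.Adj a b → 0 < w s(a, b)) :
    ∀ v ∈ X, ∃ (p : ℕ → V) (m : ℕ), p 0 = x ∧ p m = v ∧ (∀ i ≤ m, p i ∈ X) ∧
      ∀ i < m, G.Adj (p i) (p (i + 1)) ∧ F (p (i + 1)) = F (p i) + w s(p i, p (i + 1)) := by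
  refine hF.induction hw (fun v hv hS _ => ?_) fun a ha v hv hadj he hPa => ?_
  · exact ⟨fun _ => v, 0, hS, rfl, fun _ _ => hv, by simp⟩
  · obtain ⟨p, m, h0, hm, hX, hp⟩ := hPa
    refine ⟨fun i => if i ≤ m then p i else v, m + 1, by simpa using h0, by simp, ?_, ?_⟩
    · intro i _
      by_cases him : i ≤ m
      · simpa [him] using hX i him
      · simpa [him] using hv
    · intro i hi
      rcases Nat.lt_succ_iff_lt_or_eq.1 hi with him | rfl
      · simpa [him.le, Nat.succ_le_of_lt him] using hp i him
      · simpa [hm] using ⟨hadj, he⟩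

end Potentials

/-- In a finite connected graph with positive weights there is a distance potential from every
vertex. -/
theorem SimpleGraph.Connected.exists_isPotential {V : Type} [Fintype V] {G : SimpleGraph V}
    {w : Sym2 V → ℝ} (hG : G.Connected) (hw : ∀ e ∈ G.edgeSet, 0 < w e) (u : V) :
    ∃ F, IsPotential G Finset.univ w {u} (fun _ => 0) F := by
  refine _root_.exists_isPotential G Finset.univ w {u} (fun _ => 0)
    (fun a _ b _ hab => (hw _ hab).le) (fun v => G.dist u v) fun v _ => ?_
  rcases eq_or_ne v u with rfl | hvu
  · exact Or.inl rfl
  · obtain ⟨p, hp⟩ := hG.exists_walk_length_eq_dist v u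
    cases p with
    | nil => exact absurd rfl hvu
    | @cons _ c _ hadj q =>
      refine Or.inr ⟨c, Finset.mem_univ _, hadj.symm, ?_⟩
      have h1 := SimpleGraph.dist_le q
      rw [SimpleGraph.Walk.length_cons] at hp
      rw [SimpleGraph.dist_comm, SimpleGraph.dist_comm (u := u)]
      exact_mod_cast (by omega : G.dist c u < G.dist v u)

/-- In a finite connected graph with positive weights the weighted distance is attained. -/
theorem exists_walk_sum_le_wdist {V : Type} [Fintype V] {G : SimpleGraph V} {w : Sym2 V → ℝ}
    (hG : G.Connected) (hw : ∀ e ∈ G.edgeSet, 0 < w e) (u v : V) :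
    ∃ p : G.Walk u v, (p.edges.map w).sum ≤ wdist G w u v := by
  obtain ⟨F, hF⟩ := hG.exists_isPotential hw u
  have hlow : ∀ {a b : V} (p : G.Walk a b), F b - F a ≤ (p.edges.map w).sum := by
    intro a b p
    induction p with
    | nil => simp
    | @cons a c b hac q ih =>
      have := hF.lipschitz a (Finset.mem_univ _) c (Finset.mem_univ _) hac
      simp only [SimpleGraph.Walk.edges_cons, List.map_cons, List.sum_cons]
      linarith
  have hw' : ∀ a ∈ Finset.univ, ∀ b ∈ Finset.univ, G.Adj a b → 0 < w s(a, b) :=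
    fun a _ b _ hab => hw _ hab
  have hF0 : 0 ≤ F u := hF.nonneg hw' (by simp) u (Finset.mem_univ _)
  have hup : ∀ v ∈ Finset.univ, ∃ p : G.Walk u v, (p.edges.map w).sum ≤ F v := by
    refine hF.induction hw' ?_ ?_
    · rintro v - rfl hv
      exact ⟨SimpleGraph.Walk.nil, by simp [hF0]⟩
    · rintro a - v - hadj he ⟨p, hp⟩
      exact ⟨p.concat hadj, by simp [SimpleGraph.Walk.edges_concat, he, hp]⟩
  obtain ⟨p, hp⟩ := hup v (Finset.mem_univ _)
  refine ⟨p, hp.trans (le_csInf ⟨_, p, rfl⟩ ?_)⟩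
  rintro _ ⟨q, rfl⟩
  have := hlow q
  have := hF.le_source u rfl (Finset.mem_univ _)
  linarith

/-! ### Region growing -/

section RegionGrowing

open MeasureTheory in
/-- Averaging: some radius `r`, avoiding a given finite set, meets intervals of small total
weight. -/
theorem exists_sum_filter_abs_sub_le {ι : Type*} (Q : Finset ι) (c z b : ι → ℝ)
    (hc : ∀ p ∈ Q, 0 ≤ c p) (hb : ∀ p ∈ Q, 0 ≤ b p) {s t : ℝ} (hst : s < t) (E : Finset ℝ) :
    ∃ r ∈ Set.Icc s t, r ∉ E ∧
      (t - s) * ∑ p ∈ Q with |z p - r| ≤ b p, c p ≤ ∑ p ∈ Q, 2 * (c p * b p) := by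
  set μ : Measure ℝ := volume.restrict (Set.Icc s t) with hμ
  have hμuniv : μ.real Set.univ = t - s := by
    simp [hμ, hst.le]
  have hμ0 : μ ≠ 0 := by
    intro h
    rw [h] at hμuniv
    simp at hμuniv
    linarith
  set I : ι → Set ℝ := fun p => Set.Icc (z p - b p) (z p + b p) with hI
  have hint : ∀ p ∈ Q, Integrable ((I p).indicator fun _ => c p) μ := fun p _ =>
    (integrable_const (c p)).indicator measurableSet_Icc
  have hN : μ (↑E ∪ (Set.Icc s t)ᶜ) = 0 := by
    refine measure_union_null ?_ ?_
    · exact E.finite_toSet.measure_zero _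
    · rw [hμ, Measure.restrict_apply measurableSet_Icc.compl]
      simp
  obtain ⟨r, hrN, hr⟩ := exists_notMem_null_le_average hμ0
    (integrable_finsetSum Q hint) hN
  simp only [Set.mem_union, not_or, Set.notMem_compl_iff, Finset.mem_coe] at hrN
  refine ⟨r, hrN.2, hrN.1, ?_⟩
  have hsum : ∑ p ∈ Q with |z p - r| ≤ b p, c p = ∑ p ∈ Q, (I p).indicator (fun _ => c p) r := by
    rw [Finset.sum_filter]
    refine Finset.sum_congr rfl fun p _ => ?_
    have : |z p - r| ≤ b p ↔ r ∈ I p := by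
      rw [hI, Set.mem_Icc, abs_le]
      constructor <;> rintro ⟨h1, h2⟩ <;> constructor <;> linarith
    by_cases hp : r ∈ I p
    · rw [if_pos (this.2 hp), Set.indicator_of_mem hp]
    · rw [if_neg (fun h => hp (this.1 h)), Set.indicator_of_notMem hp]
  rw [average_eq, hμuniv, smul_eq_mul, integral_finsetSum Q hint] at hr
  have hbound : ∀ p ∈ Q, ∫ x, (I p).indicator (fun _ => c p) x ∂μ ≤ 2 * (c p * b p) := by
    intro p hp
    rw [integral_indicator_const _ measurableSet_Icc, smul_eq_mul]
    have h1 : μ.real (I p) ≤ 2 * b p := by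
      calc μ.real (I p) ≤ volume.real (I p) := by
            refine ENNReal.toReal_mono (by simp [hI]) ?_
            exact Measure.restrict_apply_le _ _
        _ = 2 * b p := by
            rw [hI, Real.volume_real_Icc_of_le (by linarith [hb p hp])]; ring
    nlinarith [hc p hp]
  have hts : 0 < t - s := by linarith
  rw [hsum]
  calc (t - s) * ∑ p ∈ Q, (I p).indicator (fun _ => c p) r
      ≤ (t - s) * ((t - s)⁻¹ * ∑ p ∈ Q, ∫ x, (I p).indicator (fun _ => c p) x ∂μ) := by
        refine mul_le_mul_of_nonneg_left ?_ hts.le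
        simpa using hr
    _ = ∑ p ∈ Q, ∫ x, (I p).indicator (fun _ => c p) x ∂μ := by
        rw [mul_inv_cancel_left₀ hts.ne']
    _ ≤ _ := Finset.sum_le_sum hbound

/-- A monotone function bounded by half of `M` has a point where it at most doubles over a
distance inversely proportional to the logarithm of its relative size. -/
theorem exists_slow_growth {y : ℝ → ℝ} (hy : Monotone y) {M α β L : ℝ} (hαβ : α < β)
    (hα : 0 < y α) (hβ : y β ≤ M / 2) (hL : 0 < L)
    (hlog : 1 + Real.log (2 * Real.log (M / y α)) ≤ L) :
    ∃ s, α ≤ s ∧ s ≤ β ∧ s + (β - α) / (2 * Real.log (M / y s) * L) ≤ β ∧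
      y (s + (β - α) / (2 * Real.log (M / y s) * L)) ≤ 2 * y s := by
  set φ : ℝ → ℝ := fun s => 2 * Real.log (M / y s) with hφ
  have hypos : ∀ s, α ≤ s → 0 < y s := fun s hs => hα.trans_le (hy hs)
  have hM : 0 < M := by linarith [hypos β hαβ.le]
  have hφ1 : ∀ s, α ≤ s → s ≤ β → 1 < φ s := by
    intro s h1 h2
    have hys := hypos s h1
    have h3 : (2 : ℝ) ≤ M / y s := by
      rw [le_div_iff₀ hys]
      linarith [hy h2]
    have := Real.log_le_log (by norm_num) h3
    have := Real.log_two_gt_d9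
    simp only [hφ]
    linarith
  have key : ∀ n : ℕ, ∀ s, α ≤ s → s ≤ β → φ s ≤ n →
      s + (β - α) / L * (1 + Real.log (φ s)) ≤ β →
      ∃ s, α ≤ s ∧ s ≤ β ∧ s + (β - α) / (φ s * L) ≤ β ∧
        y (s + (β - α) / (φ s * L)) ≤ 2 * y s := by
    have hθ : 0 < (β - α) / L := div_pos (by linarith) hL
    intro n
    induction n with
    | zero =>
      intro s h1 h2 h3
      have := hφ1 s h1 h2
      norm_num at h3
      linarith
    | succ n ih =>
      intro s h1 h2 h3 h4
      have hs1 := hφ1 s h1 h2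
      have hτ : (β - α) / (φ s * L) = (β - α) / L * (1 / φ s) := by
        field_simp
      have hle : 1 / φ s ≤ 1 + Real.log (φ s) := by
        have := Real.one_sub_inv_le_log_of_pos (zero_lt_one.trans hs1)
        have h5 : 1 / φ s < 1 := by rw [div_lt_one (by linarith)]; exact hs1
        linarith [Real.log_pos hs1]
      have hend : s + (β - α) / (φ s * L) ≤ β := by
        rw [hτ]
        linarith [mul_le_mul_of_nonneg_left hle hθ.le]
      by_cases hgood : y (s + (β - α) / (φ s * L)) ≤ 2 * y s
      · exact ⟨s, h1, h2, hend, hgood⟩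
      push Not at hgood
      set s' := s + (β - α) / (φ s * L) with hs'
      have hss' : s ≤ s' := by
        rw [hs', hτ]
        have : 0 < 1 / φ s := by positivity
        linarith [mul_pos hθ this]
      have hs'1 := hφ1 s' (h1.trans hss') hend
      have hdec : φ s' ≤ φ s - 1 := by
        have h5 : Real.log (M / y s') ≤ Real.log (M / (2 * y s)) := by
          have := hypos s h1
          have := hypos s' (h1.trans hss')
          refine Real.log_le_log (by positivity) ?_
          exact div_le_div_of_nonneg_left hM.le (by positivity) hgood.le
        have h6 : Real.log (M / (2 * y s)) = Real.log (M / y s) - Real.log 2 := by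
          have := hypos s h1
          rw [← Real.log_div (by positivity) (by norm_num)]
          congr 1
          field_simp
        have := Real.log_two_gt_d9
        simp only [hφ]
        linarith
      refine ih s' (h1.trans hss') hend ?_ ?_
      · push_cast at h3
        linarith
      · have h7 : 1 / φ s + Real.log (φ s') ≤ Real.log (φ s) := by
          have h8 : Real.log (φ s') - Real.log (φ s) ≤ φ s' / φ s - 1 := by
            rw [← Real.log_div (by linarith) (by linarith)]
            exact Real.log_le_sub_one_of_pos (div_pos (by linarith) (by linarith))
          have h9 : φ s' / φ s ≤ 1 - 1 / φ s := by
            rw [div_le_iff₀ (by linarith), sub_mul, one_div, inv_mul_cancel₀ (by linarith)]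
            linarith
          linarith
        have h8 : s' = s + (β - α) / L * (1 / φ s) := by rw [hs', hτ]
        linarith [mul_le_mul_of_nonneg_left h7 hθ.le]
  obtain ⟨n, hn⟩ := exists_nat_ge (φ α)
  refine key n α le_rfl hαβ.le hn ?_
  have h1 : (β - α) / L * (1 + Real.log (φ α)) ≤ (β - α) / L * L :=
    mul_le_mul_of_nonneg_left hlog (div_nonneg (by linarith) hL.le)
  rw [div_mul_cancel₀ _ hL.ne'] at h1
  linarith

/-- The total mass of the vertices of `X` at which `ρ` is at most `r`. -/
noncomputable def sublevelMass {V : Type} (X : Finset V) (m ρ : V → ℝ) (r : ℝ) : ℝ :=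
  ∑ v ∈ X with ρ v ≤ r, m v

theorem sublevelMass_mono {V : Type} {X : Finset V} {m : V → ℝ} (ρ : V → ℝ)
    (hm : ∀ v ∈ X, 0 ≤ m v) : Monotone (sublevelMass X m ρ) := by
  intro r s hrs
  refine Finset.sum_le_sum_of_subset_of_nonneg ?_ ?_
  · intro v
    simp only [Finset.mem_filter]
    exact fun h => ⟨h.1, h.2.trans hrs⟩
  · intro v hv _
    exact hm v (Finset.mem_filter.1 hv).1

open Classical in
/-- Region growing in one direction: there is a radius in `[α, β]` at which the total weight of
the pairs that may be cut is bounded in terms of the mass of the sublevel set. -/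
theorem exists_sparse_radius {V ι : Type} {X : Finset V} {m ρ : V → ℝ} {α β Λ L : ℝ}
    (hm : ∀ v ∈ X, 0 ≤ m v) (hαβ : α < β) (hα : 0 < sublevelMass X m ρ α)
    (hβ : sublevelMass X m ρ β ≤ (∑ v ∈ X, m v) / 2) (hL : 1 + Real.log Λ ≤ L)
    (hΛ : 2 * Real.log ((∑ v ∈ X, m v) / sublevelMass X m ρ α) ≤ Λ)
    {Q : Finset ι} {o : ι → V} {c ℓ : ι → ℝ} (hc : ∀ p ∈ Q, 0 ≤ c p) (hℓ : ∀ p ∈ Q, 0 ≤ ℓ p)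
    (ho : ∀ p ∈ Q, o p ∈ X)
    (hmass : ∀ v ∈ X, ∑ p ∈ Q with o p = v, c p * ℓ p ≤ m v)
    (hshort : ∀ p ∈ Q, β < ρ (o p) - 4 * ℓ p ∨ 8 * (ℓ p * (Λ * L)) ≤ β - α) (E : Finset ℝ) :
    ∃ r ∈ Set.Icc α β, r ∉ E ∧
      (β - α) * ∑ p ∈ Q with |ρ (o p) - r| ≤ 4 * ℓ p, c p ≤
        128 * (L * (sublevelMass X m ρ r *
          Real.log ((∑ v ∈ X, m v) / sublevelMass X m ρ r))) := by
  set y := sublevelMass X m ρ with hy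
  set M := ∑ v ∈ X, m v with hM
  have hmono : Monotone y := sublevelMass_mono ρ hm
  have hypos : ∀ s, α ≤ s → 0 < y s := fun s hs => hα.trans_le (hmono hs)
  have hMpos : 0 < M := by linarith [hypos β hαβ.le]
  have hlog2 := Real.log_two_gt_d9
  have hlogy : ∀ s, α ≤ s → s ≤ β → Real.log 2 ≤ Real.log (M / y s) := by
    intro s h1 h2
    refine Real.log_le_log (by norm_num) ?_
    rw [le_div_iff₀ (hypos s h1)]
    linarith [hmono h2]
  have hanti : ∀ s t, α ≤ s → s ≤ t → Real.log (M / y t) ≤ Real.log (M / y s) := by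
    intro s t h1 h2
    have h3 := hypos s h1
    have h4 := hypos t (h1.trans h2)
    exact Real.log_le_log (by positivity)
      (div_le_div_of_nonneg_left hMpos.le h3 (hmono h2))
  have hαlog := hlogy α le_rfl hαβ.le
  have hΛ1 : 1 < Λ := by linarith
  have hLpos : 0 < L := by linarith [Real.log_pos hΛ1]
  obtain ⟨s, hs1, hsβ, hs2, hs3⟩ := exists_slow_growth hmono hαβ hα hβ hLpos
    (by linarith [Real.log_le_log (by linarith) hΛ])
  set φ := Real.log (M / y s) with hφ
  set τ := (β - α) / (2 * φ * L) with hτ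
  have hφpos : 0 < φ := by linarith [hlogy s hs1 hsβ]
  have hφΛ : 2 * φ ≤ Λ := by linarith [hanti α s le_rfl hs1]
  have hτpos : 0 < τ := div_pos (by linarith) (by positivity)
  have hτmul : τ * (2 * φ * L) = β - α := div_mul_cancel₀ _ (by positivity)
  set Q' := Q.filter fun p => 8 * (ℓ p * (Λ * L)) ≤ β - α ∧ ρ (o p) ≤ s + τ with hQ'
  have hQ'Q : ∀ p ∈ Q', p ∈ Q := fun p hp => (Finset.mem_filter.1 hp).1
  obtain ⟨r, hr, hrE, hsum⟩ := exists_sum_filter_abs_sub_le Q' c (fun p => ρ (o p))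
    (fun p => 4 * ℓ p) (fun p hp => hc p (hQ'Q p hp))
    (fun p hp => by linarith [hℓ p (hQ'Q p hp)]) (show s < s + τ / 2 by linarith) E
  have hrβ : r ≤ β := by linarith [hr.2]
  have hrα : α ≤ r := hs1.trans hr.1
  refine ⟨r, ⟨hrα, hrβ⟩, hrE, ?_⟩
  have hfilter : (Q.filter fun p => |ρ (o p) - r| ≤ 4 * ℓ p) =
      Q'.filter fun p => |ρ (o p) - r| ≤ 4 * ℓ p := by
    ext p
    simp only [hQ', Finset.mem_filter]
    refine ⟨fun ⟨hp, hpr⟩ => ⟨⟨hp, ?_⟩, hpr⟩, fun h => ⟨h.1.1, h.2⟩⟩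
    have h1 := abs_le.1 hpr
    have hshortp : 8 * (ℓ p * (Λ * L)) ≤ β - α :=
      (hshort p hp).resolve_left (by intro h; linarith)
    refine ⟨hshortp, ?_⟩
    have h2 : ℓ p * (2 * φ * L) ≤ ℓ p * (Λ * L) :=
      mul_le_mul_of_nonneg_left (mul_le_mul_of_nonneg_right hφΛ hLpos.le) (hℓ p hp)
    have h3 : 8 * ℓ p ≤ τ := by
      rw [hτ, le_div_iff₀ (by positivity)]
      linarith
    linarith [hr.2]
  have hmassQ' : ∑ p ∈ Q', c p * ℓ p ≤ y (s + τ) := by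
    calc ∑ p ∈ Q', c p * ℓ p
        = ∑ v ∈ X with ρ v ≤ s + τ, ∑ p ∈ Q' with o p = v, c p * ℓ p := by
          refine (Finset.sum_fiberwise_of_maps_to (fun p hp => ?_) _).symm
          have := Finset.mem_filter.1 hp
          exact Finset.mem_filter.2 ⟨ho p this.1, this.2.2⟩
      _ ≤ ∑ v ∈ X with ρ v ≤ s + τ, m v := by
          refine Finset.sum_le_sum fun v hv => ?_
          refine le_trans ?_ (hmass v (Finset.mem_filter.1 hv).1)
          refine Finset.sum_le_sum_of_subset_of_nonneg
            (Finset.filter_subset_filter _ (Finset.filter_subset _ _)) fun p hp _ => ?_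
          have := (Finset.mem_filter.1 hp).1
          exact mul_nonneg (hc p this) (hℓ p this)
  have hyr : y r ≤ 2 * y s := (hmono (by linarith [hr.2])).trans hs3
  have hys := hypos s hs1
  have hyrpos := hypos r hrα
  have hφr : φ ≤ 2 * Real.log (M / y r) := by
    have h1 := hlogy r hrα hrβ
    have h2 : φ ≤ Real.log (2 * (M / y r)) := by
      refine Real.log_le_log (by positivity) ?_
      rw [← mul_div_assoc, div_le_div_iff₀ hys hyrpos]
      nlinarith
    rw [Real.log_mul (by norm_num) (by positivity)] at h2
    linarith
  rw [hfilter]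
  set S := ∑ p ∈ Q' with |ρ (o p) - r| ≤ 4 * ℓ p, c p with hS
  have h1 : τ * S ≤ 32 * y s := by
    have : ∑ p ∈ Q', 2 * (c p * (4 * ℓ p)) = 8 * ∑ p ∈ Q', c p * ℓ p := by
      rw [Finset.mul_sum]
      exact Finset.sum_congr rfl fun _ _ => by ring
    rw [this] at hsum
    linarith
  calc (β - α) * S = (τ * S) * (2 * φ * L) := by rw [← hτmul]; ring
    _ ≤ (32 * y s) * (2 * φ * L) := mul_le_mul_of_nonneg_right h1 (by positivity)
    _ ≤ (32 * y r) * (2 * (2 * Real.log (M / y r)) * L) := by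
      have := hmono hr.1
      gcongr
    _ = _ := by ring

end RegionGrowing

section TwoSidedGrowth

variable {V ι : Type} {K : Set V} {m F L : V → ℝ}

/-- Masses `m` together with parameters `F` and `L` controlling the logarithm of the relative
mass of a vertex in a cluster and its iterated logarithm.  The parameters are smallest on the
terminals `K`, and largest outside. -/
structure IsScale (K : Set V) (m F L : V → ℝ) : Prop where
  mass_pos : ∀ v, 0 < m v
  one_le : ∀ v, 1 ≤ F v
  log_le : ∀ v, 1 + Real.log (F v) ≤ L v
  le_of_mem : ∀ v ∈ K, ∀ u, F v ≤ F u ∧ L v ≤ L u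
  le_of_notMem : ∀ v ∉ K, ∀ u, F u ≤ F v ∧ L u ≤ L v
  log_mass_le : ∀ X : Finset V, ∀ v ∈ X, 2 * Real.log ((∑ u ∈ X, m u) / m v) ≤ F v

theorem IsScale.one_le_snd (hs : IsScale K m F L) (v : V) : 1 ≤ L v := by
  linarith [hs.log_le v, Real.log_nonneg (hs.one_le v)]

theorem IsScale.one_le_mul (hs : IsScale K m F L) (v : V) : 1 ≤ F v * L v :=
  one_le_mul_of_one_le_of_one_le (hs.one_le v) (hs.one_le_snd v)

theorem IsScale.sum_pos (hs : IsScale K m F L) {X : Finset V} (hX : X.Nonempty) :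
    0 < ∑ v ∈ X, m v :=
  Finset.sum_pos (fun v _ => hs.mass_pos v) hX

theorem IsScale.sum_mono (hs : IsScale K m F L) {S X : Finset V} (hSX : S ⊆ X) :
    ∑ v ∈ S, m v ≤ ∑ v ∈ X, m v :=
  Finset.sum_le_sum_of_subset_of_nonneg hSX fun v _ _ => (hs.mass_pos v).le

theorem IsScale.log_div_nonneg (hs : IsScale K m F L) {S X : Finset V} (hSX : S ⊆ X)
    (hS : S.Nonempty) : 0 ≤ Real.log ((∑ v ∈ X, m v) / ∑ v ∈ S, m v) :=
  Real.log_nonneg ((one_le_div (hs.sum_pos hS)).2 (hs.sum_mono hSX))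

theorem le_sublevelMass (hs : IsScale K m F L) {X : Finset V} {ρ : V → ℝ} {v : V} {r : ℝ}
    (hv : v ∈ X) (hr : ρ v ≤ r) : m v ≤ sublevelMass X m ρ r :=
  Finset.single_le_sum (f := m) (fun u _ => (hs.mass_pos u).le) (Finset.mem_filter.2 ⟨hv, hr⟩)

open Classical in
/-- Two-phase region growing: the bound uses the small parameters as soon as the region
contains a terminal. -/
theorem IsScale.exists_radius_one_sided (hs : IsScale K m F L) {X : Finset V} {ρ : V → ℝ}
    {α β : ℝ} (hαβ : α < β) (hα : ∃ v ∈ X, ρ v ≤ α)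
    (hβ : sublevelMass X m ρ β ≤ (∑ v ∈ X, m v) / 2)
    {Q : Finset ι} {o : ι → V} {c ℓ : ι → ℝ} (hc : ∀ p ∈ Q, 0 ≤ c p) (hℓ : ∀ p ∈ Q, 0 ≤ ℓ p)
    (ho : ∀ p ∈ Q, o p ∈ X)
    (hmass : ∀ v ∈ X, ∑ p ∈ Q with o p = v, c p * ℓ p ≤ m v)
    (hshort : ∀ p ∈ Q, 32 * (ℓ p * (F (o p) * L (o p))) ≤ β - α) (E : Finset ℝ) :
    ∃ r ∈ Set.Icc α β, r ∉ E ∧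
      (β - α) * ∑ p ∈ Q with |ρ (o p) - r| ≤ 4 * ℓ p, c p ≤
        512 * ∑ v ∈ X with ρ v ≤ r, m v * L v *
          Real.log ((∑ v ∈ X, m v) / ∑ v ∈ X with ρ v ≤ r, m v) := by
  have hm : ∀ v ∈ X, 0 ≤ m v := fun v _ => (hs.mass_pos v).le
  have hmono := sublevelMass_mono ρ hm
  have hΛ : ∀ v ∈ X, ∀ r, ρ v ≤ r →
      2 * Real.log ((∑ v ∈ X, m v) / sublevelMass X m ρ r) ≤ F v := by
    intro v hv r hr
    refine le_trans ?_ (hs.log_mass_le X v hv)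
    have h1 := le_sublevelMass hs hv hr
    have h2 := hs.mass_pos v
    have h3 := hs.sum_pos ⟨v, hv⟩
    have h4 : 0 < sublevelMass X m ρ r := h2.trans_le h1
    have := Real.log_le_log (by positivity) (div_le_div_of_nonneg_left h3.le h2 h1)
    linarith
  have conclude : ∀ α' β' r, ∀ v₀, (β - α) / 4 ≤ β' - α' → (∃ v ∈ X, ρ v ≤ r) →
      (∀ v ∈ X, ρ v ≤ r → L v₀ ≤ L v) →
      (β' - α') * ∑ p ∈ Q with |ρ (o p) - r| ≤ 4 * ℓ p, c p ≤
        128 * (L v₀ * (sublevelMass X m ρ r *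
          Real.log ((∑ v ∈ X, m v) / sublevelMass X m ρ r))) →
      (β - α) * ∑ p ∈ Q with |ρ (o p) - r| ≤ 4 * ℓ p, c p ≤
        512 * ∑ v ∈ X with ρ v ≤ r, m v * L v *
          Real.log ((∑ v ∈ X, m v) / ∑ v ∈ X with ρ v ≤ r, m v) := by
    intro α' β' r v₀ hwidth ⟨u, hu, hur⟩ hLv hsum
    have h1 : 0 ≤ ∑ p ∈ Q with |ρ (o p) - r| ≤ 4 * ℓ p, c p :=
      Finset.sum_nonneg fun p hp => hc p (Finset.mem_filter.1 hp).1
    have h2 := mul_le_mul_of_nonneg_right hwidth h1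
    have hlog := hs.log_div_nonneg (Finset.filter_subset (fun v => ρ v ≤ r) X)
      ⟨u, Finset.mem_filter.2 ⟨hu, hur⟩⟩
    have h3 : L v₀ * (sublevelMass X m ρ r *
          Real.log ((∑ v ∈ X, m v) / sublevelMass X m ρ r)) ≤
        ∑ v ∈ X with ρ v ≤ r, m v * L v *
          Real.log ((∑ v ∈ X, m v) / ∑ v ∈ X with ρ v ≤ r, m v) := by
      unfold sublevelMass
      rw [← mul_assoc, Finset.mul_sum, Finset.sum_mul]
      refine Finset.sum_le_sum fun v hv => mul_le_mul_of_nonneg_right ?_ hlog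
      rw [mul_comm]
      rw [Finset.mem_filter] at hv
      exact mul_le_mul_of_nonneg_left (hLv v hv.1 hv.2) (hm v hv.1)
    linarith
  obtain ⟨v₀, hv₀, hρ₀⟩ := hα
  by_cases hterm : ∃ v ∈ X, v ∈ K ∧ ρ v ≤ (α + β) / 2
  · obtain ⟨v₁, hv₁, hvK, hρ₁⟩ := hterm
    have hlen : ∀ p ∈ Q, 8 * (ℓ p * (F v₁ * L v₁)) ≤ β - (α + β) / 2 := by
      intro p hp
      obtain ⟨h1, h2⟩ := hs.le_of_mem v₁ hvK (o p)
      have h3 : F v₁ * L v₁ ≤ F (o p) * L (o p) :=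
        mul_le_mul h1 h2 (by linarith [hs.one_le_snd v₁]) (by linarith [hs.one_le (o p)])
      have := mul_le_mul_of_nonneg_left h3 (hℓ p hp)
      linarith [hshort p hp]
    obtain ⟨r, hr, hrE, hsum⟩ := exists_sparse_radius hm (show (α + β) / 2 < β by linarith)
      ((hs.mass_pos v₁).trans_le (le_sublevelMass hs hv₁ hρ₁)) hβ (hs.log_le v₁)
      (hΛ v₁ hv₁ _ hρ₁) hc hℓ ho hmass (fun p hp => Or.inr (hlen p hp)) E
    refine ⟨r, ⟨by linarith [hr.1], hr.2⟩, hrE, ?_⟩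
    exact conclude _ _ r v₁ (by linarith) ⟨v₁, hv₁, hρ₁.trans hr.1⟩
      (fun v _ _ => (hs.le_of_mem v₁ hvK v).2) hsum
  · push Not at hterm
    have hv₀K : v₀ ∉ K := fun h => by linarith [hterm v₀ hv₀ h]
    have hlen : ∀ p ∈ Q, α + (β - α) / 4 < ρ (o p) - 4 * ℓ p ∨
        8 * (ℓ p * (F v₀ * L v₀)) ≤ α + (β - α) / 4 - α := by
      intro p hp
      by_cases hpK : o p ∈ K
      · left
        have h1 := mul_le_mul_of_nonneg_left (hs.one_le_mul (o p)) (hℓ p hp)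
        linarith [hterm _ (ho p hp) hpK, hshort p hp]
      · right
        obtain ⟨h1, h2⟩ := hs.le_of_notMem _ hpK v₀
        have h3 : F v₀ * L v₀ ≤ F (o p) * L (o p) :=
          mul_le_mul h1 h2 (by linarith [hs.one_le_snd v₀]) (by linarith [hs.one_le (o p)])
        have := mul_le_mul_of_nonneg_left h3 (hℓ p hp)
        linarith [hshort p hp]
    obtain ⟨r, hr, hrE, hsum⟩ := exists_sparse_radius hm
      (show α < α + (β - α) / 4 by linarith)
      ((hs.mass_pos v₀).trans_le (le_sublevelMass hs hv₀ hρ₀))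
      ((hmono (show α + (β - α) / 4 ≤ β by linarith)).trans hβ) (hs.log_le v₀)
      (hΛ v₀ hv₀ _ hρ₀) hc hℓ ho hmass hlen E
    refine ⟨r, ⟨hr.1, by linarith [hr.2]⟩, hrE, ?_⟩
    refine conclude _ _ r v₀ (by linarith) ⟨v₀, hv₀, hρ₀.trans hr.1⟩ (fun v hv hvr => ?_) hsum
    exact (hs.le_of_notMem v (fun hvK => by linarith [hterm v hv hvK, hr.2]) v₀).2

/-- The entropy-like potential of a cluster, paying for its future cuts. -/
noncomputable def clusterEntropy (m L : V → ℝ) (X : Finset V) : ℝ :=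
  ∑ v ∈ X, m v * L v * Real.log ((∑ u ∈ X, m u) / m v)

theorem IsScale.clusterEntropy_nonneg (hs : IsScale K m F L) (X : Finset V) :
    0 ≤ clusterEntropy m L X := by
  refine Finset.sum_nonneg fun v hv => ?_
  have h1 := hs.mass_pos v
  have h2 := hs.one_le_snd v
  have h3 := hs.log_div_nonneg (Finset.singleton_subset_iff.2 hv) (Finset.singleton_nonempty v)
  rw [Finset.sum_singleton] at h3
  positivity

theorem IsScale.clusterEntropy_le (hs : IsScale K m F L) (X : Finset V) :
    clusterEntropy m L X ≤ ∑ v ∈ X, m v * (F v * L v) := by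
  refine Finset.sum_le_sum fun v hv => ?_
  have h1 := hs.mass_pos v
  have h2 := hs.one_le_snd v
  have h3 := hs.log_mass_le X v hv
  have h4 := hs.one_le v
  have : Real.log ((∑ u ∈ X, m u) / m v) ≤ F v := by linarith
  calc m v * L v * Real.log ((∑ u ∈ X, m u) / m v) ≤ m v * L v * F v :=
        mul_le_mul_of_nonneg_left this (by positivity)
    _ = _ := by ring

/-- Splitting a cluster releases entropy in proportion to the mass of either side. -/
theorem IsScale.clusterEntropy_split (hs : IsScale K m F L) {X S R : Finset V}
    (hS : S.Nonempty) (hdisj : Disjoint S R) [DecidableEq V] (hX : S ∪ R = X) :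
    ∑ v ∈ S, m v * L v * Real.log ((∑ u ∈ X, m u) / ∑ u ∈ S, m u) +
      (clusterEntropy m L S + clusterEntropy m L R) ≤ clusterEntropy m L X := by
  have hSX : S ⊆ X := hX ▸ Finset.subset_union_left
  have hRX : R ⊆ X := hX ▸ Finset.subset_union_right
  have hsplit : clusterEntropy m L X =
      ∑ v ∈ S, m v * L v * Real.log ((∑ u ∈ X, m u) / m v) +
      ∑ v ∈ R, m v * L v * Real.log ((∑ u ∈ X, m u) / m v) := by
    rw [← Finset.sum_union hdisj, hX, clusterEntropy]
  rw [hsplit, ← add_assoc]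
  refine add_le_add ?_ ?_
  · rw [clusterEntropy, ← Finset.sum_add_distrib]
    refine le_of_eq (Finset.sum_congr rfl fun v hv => ?_)
    have h1 := hs.mass_pos v
    have h2 := hs.sum_pos hS
    have h3 := hs.sum_pos (hS.mono hSX)
    rw [← mul_add, ← Real.log_mul (by positivity) (by positivity)]
    congr 2
    field_simp
  · refine Finset.sum_le_sum fun v hv => ?_
    have h1 := hs.mass_pos v
    have h2 := hs.one_le_snd v
    have h3 := hs.sum_pos ⟨v, hv⟩
    refine mul_le_mul_of_nonneg_left (Real.log_le_log (by positivity) ?_) (by positivity)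
    exact div_le_div_of_nonneg_right (hs.sum_mono hRX) h1.le

open Classical in
/-- Two-sided region growing: there is a threshold in `[α, β]` such that the weight of the
pairs which may be cut is paid for by the released entropy. -/
theorem IsScale.exists_radius (hs : IsScale K m F L) {X : Finset V} {ρ : V → ℝ}
    {α β : ℝ} (hαβ : α < β) (hα : ∃ v ∈ X, ρ v ≤ α) (hβ : ∃ v ∈ X, β ≤ ρ v)
    {Q : Finset ι} {o : ι → V} {c ℓ : ι → ℝ} (hc : ∀ p ∈ Q, 0 ≤ c p) (hℓ : ∀ p ∈ Q, 0 ≤ ℓ p)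
    (ho : ∀ p ∈ Q, o p ∈ X)
    (hmass : ∀ v ∈ X, ∑ p ∈ Q with o p = v, c p * ℓ p ≤ m v)
    (hshort : ∀ p ∈ Q, 128 * (ℓ p * (F (o p) * L (o p))) ≤ β - α) :
    ∃ r ∈ Set.Icc α β, (β - α) * ∑ p ∈ Q with |ρ (o p) - r| ≤ 4 * ℓ p, c p +
        2048 * (clusterEntropy m L {v ∈ X | ρ v ≤ r} + clusterEntropy m L {v ∈ X | ¬ ρ v ≤ r}) ≤
      2048 * clusterEntropy m L X := by
  have hnn : ∀ p ∈ Q, 0 ≤ ℓ p * (F (o p) * L (o p)) := fun p hp =>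
    mul_nonneg (hℓ p hp) (zero_le_one.trans (hs.one_le_mul _))
  have hsplit : ∀ r : ℝ, sublevelMass X m ρ r + ∑ v ∈ X with ¬ ρ v ≤ r, m v = ∑ v ∈ X, m v :=
    fun r => Finset.sum_filter_add_sum_filter_not X _ _
  rcases le_or_gt (sublevelMass X m ρ ((α + β) / 2)) ((∑ v ∈ X, m v) / 2) with hhalf | hhalf
  · obtain ⟨r, hr, -, hsum⟩ := hs.exists_radius_one_sided
      (show α < (α + β) / 2 by linarith) hα hhalf hc hℓ ho hmass
      (fun p hp => by linarith [hshort p hp, hnn p hp]) ∅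
    refine ⟨r, ⟨hr.1, by linarith [hr.2]⟩, ?_⟩
    obtain ⟨v, hv, hvα⟩ := hα
    have := hs.clusterEntropy_split (X := X) (S := {v ∈ X | ρ v ≤ r})
      (R := {v ∈ X | ¬ ρ v ≤ r}) ⟨v, Finset.mem_filter.2 ⟨hv, hvα.trans hr.1⟩⟩
      (Finset.disjoint_filter_filter_not _ _ _) (Finset.filter_union_filter_not_eq _ _)
    have h0 := hs.clusterEntropy_nonneg {v ∈ X | ρ v ≤ r}
    have h1 : 0 ≤ ∑ p ∈ Q with |ρ (o p) - r| ≤ 4 * ℓ p, c p :=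
      Finset.sum_nonneg fun p hp => hc p (Finset.mem_filter.1 hp).1
    have h2 : 0 ≤ (β - α) * ∑ p ∈ Q with |ρ (o p) - r| ≤ 4 * ℓ p, c p :=
      mul_nonneg (by linarith) h1
    linarith
  · have hupper : sublevelMass X m (fun v => -ρ v) (-((α + 3 * β) / 4)) ≤
        (∑ v ∈ X, m v) / 2 := by
      refine le_trans (Finset.sum_le_sum_of_subset_of_nonneg (t := {v ∈ X | ¬ ρ v ≤ (α + β) / 2})
        ?_ fun v _ _ => (hs.mass_pos v).le) (by linarith [hsplit ((α + β) / 2)])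
      intro v
      simp only [Finset.mem_filter, not_le]
      exact fun h => ⟨h.1, by linarith [h.2]⟩
    obtain ⟨v, hv, hvβ⟩ := hβ
    obtain ⟨r', hr, hrE, hsum⟩ := hs.exists_radius_one_sided
      (show -β < -((α + 3 * β) / 4) by linarith) ⟨v, hv, neg_le_neg hvβ⟩ hupper hc hℓ ho hmass
      (fun p hp => by linarith [hshort p hp, hnn p hp]) (X.image fun v => -ρ v)
    obtain ⟨r, rfl⟩ : ∃ r, r' = -r := ⟨-r', by ring⟩
    refine ⟨r, ⟨by linarith [hr.2], by linarith [hr.1]⟩, ?_⟩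
    have hS : (X.filter fun v => -ρ v ≤ -r) = {v ∈ X | ¬ ρ v ≤ r} := by
      refine Finset.filter_congr fun u hu => ?_
      rw [neg_le_neg_iff, not_le]
      refine ⟨fun h => lt_of_le_of_ne h fun he => hrE ?_, le_of_lt⟩
      exact Finset.mem_image.2 ⟨u, hu, by rw [he]⟩
    have hab : ∀ p, |-ρ (o p) - -r| = |ρ (o p) - r| := fun p => by
      rw [← abs_neg]; congr 1; ring
    rw [hS] at hsum
    simp only [hab] at hsum
    have hne : ({v ∈ X | ¬ ρ v ≤ r} : Finset V).Nonempty :=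
      ⟨v, hS ▸ Finset.mem_filter.2 ⟨hv, by linarith [hr.1]⟩⟩
    have := hs.clusterEntropy_split (X := X) (S := {v ∈ X | ¬ ρ v ≤ r})
      (R := {v ∈ X | ρ v ≤ r}) hne
      (Finset.disjoint_filter_filter_not _ _ _).symm
      (by rw [Finset.union_comm]; exact Finset.filter_union_filter_not_eq _ _)
    linarith

end TwoSidedGrowth

/-! ### Petals -/

/-- `q 0, …, q n` is a shortest path of the cluster `X`, starting at its center `q 0`, and `d` is
the distance from the center. -/
structure IsSpine {V : Type} (G : SimpleGraph V) (X : Finset V) (w : Sym2 V → ℝ) (q : ℕ → V)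
    (n : ℕ) (d : V → ℝ) : Prop where
  pos : ∀ a ∈ X, ∀ b ∈ X, G.Adj a b → 0 < w s(a, b)
  pot : IsPotential G X w {q 0} (fun _ => 0) d
  mem : ∀ i ≤ n, q i ∈ X
  adj : ∀ i < n, G.Adj (q i) (q (i + 1))
  step : ∀ i < n, d (q (i + 1)) = d (q i) + w s(q i, q (i + 1))

/-- The slack of a vertex `v` with respect to a path of length `D`; the petals around the path are
its sublevel sets. -/
def petalSlack {V : Type} (D : ℝ) (d g : V → ℝ) (v : V) : ℝ := D + g v - 2 * d v

section Petals

variable {V : Type} {G : SimpleGraph V} {X : Finset V} {w : Sym2 V → ℝ} {q : ℕ → V} {n : ℕ}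
  {d g : V → ℝ}

namespace IsSpine

theorem center (h : IsSpine G X w q n d) : d (q 0) = 0 :=
  le_antisymm (h.pot.le_source _ rfl (h.mem 0 n.zero_le))
    (h.pot.nonneg h.pos (by simp) _ (h.mem 0 n.zero_le))

theorem lt_of_lt (h : IsSpine G X w q n d) {i k : ℕ} (hik : i < k) (hk : k ≤ n) :
    d (q i) < d (q k) := by
  induction k, hik using Nat.le_induction with
  | base => linarith [h.step i hk, h.pos _ (h.mem i (by omega)) _ (h.mem _ hk) (h.adj i hk)]
  | succ k hik ih =>
    have := h.step k hk
    have := h.pos _ (h.mem k (by omega)) _ (h.mem _ hk) (h.adj k hk)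
    linarith [ih (by omega)]

theorem mono (h : IsSpine G X w q n d) {i k : ℕ} (hik : i ≤ k) (hk : k ≤ n) :
    d (q i) ≤ d (q k) := by
  rcases hik.eq_or_lt with rfl | hlt
  · exact le_rfl
  · exact (h.lt_of_lt hlt hk).le

/-- There is a distance function to the spine, measured with doubled weights. -/
theorem exists_petal_potential (h : IsSpine G X w q n d) :
    ∃ g, IsPotential G X (fun e => 2 * w e) {v | ∃ i ≤ n, q i = v} d g := by
  refine exists_isPotential G X _ _ d (fun a ha b hb hab => ?_) d fun v hv => ?_
  · linarith [h.pos a ha b hb hab]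
  · rcases h.pot.rank h.pos v hv with hS | ha
    · exact Or.inl ⟨0, n.zero_le, hS.symm⟩
    · exact Or.inr ha

end IsSpine

/-- The hypotheses of the petal construction: a spine and the distance function `g` to it. -/
structure IsPetalBase {V : Type} (G : SimpleGraph V) (X : Finset V) (w : Sym2 V → ℝ) (q : ℕ → V)
    (n : ℕ) (d g : V → ℝ) : Prop extends IsSpine G X w q n d where
  petal : IsPotential G X (fun e => 2 * w e) {v | ∃ i ≤ n, q i = v} d g

namespace IsPetalBase

theorem le_petal (h : IsPetalBase G X w q n d g) : ∀ v ∈ X, d v ≤ g v := by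
  refine h.petal.induction (fun a ha b hb hab => by linarith [h.pos a ha b hb hab]) ?_ ?_
  · intro v _ _ hv
    exact hv.ge
  · intro a ha v hv hadj he hle
    linarith [h.pot.lipschitz a ha v hv hadj, h.pos a ha v hv hadj]

theorem petal_spine (h : IsPetalBase G X w q n d g) {i : ℕ} (hi : i ≤ n) :
    g (q i) = d (q i) :=
  le_antisymm (h.petal.le_source _ ⟨i, hi, rfl⟩ (h.mem i hi)) (h.le_petal _ (h.mem i hi))

theorem slack_spine (h : IsPetalBase G X w q n d g) (D : ℝ) {i : ℕ} (hi : i ≤ n) :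
    petalSlack D d g (q i) = D - d (q i) := by
  rw [petalSlack, h.petal_spine hi]
  ring

theorem abs_slack_sub_le (h : IsPetalBase G X w q n d g) (D : ℝ) {a b : V} (ha : a ∈ X)
    (hb : b ∈ X) (hab : G.Adj a b) :
    |petalSlack D d g a - petalSlack D d g b| ≤ 4 * w s(a, b) := by
  have h1 := h.pot.lipschitz a ha b hb hab
  have h2 := h.pot.lipschitz b hb a ha hab.symm
  have h3 := h.petal.lipschitz a ha b hb hab
  have h4 := h.petal.lipschitz b hb a ha hab.symm
  rw [Sym2.eq_swap] at h2 h4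
  simp only [petalSlack]
  rw [abs_le]
  constructor <;> linarith

theorem le_of_slack_le (h : IsPetalBase G X w q n d g) {D r : ℝ} {v : V} (hv : v ∈ X)
    (hr : petalSlack D d g v ≤ r) : D - r ≤ d v := by
  rw [petalSlack] at hr
  linarith [h.le_petal v hv]

/-- The complement of a petal contains the shortest paths from the center. -/
theorem isPotential_compl (h : IsPetalBase G X w q n d g) {D r : ℝ} {Z : Finset V}
    (hZ : ∀ v, v ∈ Z ↔ v ∈ X ∧ ¬ petalSlack D d g v ≤ r) :
    IsPotential G Z w {q 0} (fun _ => 0) d := by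
  refine ⟨fun s hs hsZ => h.pot.le_source s hs ((hZ s).1 hsZ).1,
    fun a ha b hb => h.pot.lipschitz a ((hZ a).1 ha).1 b ((hZ b).1 hb).1, fun v hv => ?_⟩
  obtain ⟨hvX, hvr⟩ := (hZ v).1 hv
  refine (h.pot.tight v hvX).imp_right ?_
  rintro ⟨a, ha, hadj, he⟩
  refine ⟨a, (hZ a).2 ⟨ha, fun har => hvr ?_⟩, hadj, he⟩
  have := h.petal.lipschitz a ha v hvX hadj
  simp only [petalSlack] at har ⊢
  linarith

/-- The spine enters a petal exactly once. -/
theorem exists_crossing (h : IsPetalBase G X w q n d g) {r : ℝ} (hr0 : 0 ≤ r)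
    (hr : r < d (q n)) :
    ∃ j < n, ∀ i ≤ n, petalSlack (d (q n)) d g (q i) ≤ r ↔ j < i := by
  classical
  have hex : ∃ i, i ≤ n ∧ d (q n) - d (q i) ≤ r := ⟨n, le_rfl, by linarith⟩
  obtain ⟨hkn, hk⟩ := Nat.find_spec hex
  set k := Nat.find hex with hkdef
  have hk0 : k ≠ 0 := by
    intro h0
    rw [h0, h.center] at hk
    linarith
  refine ⟨k - 1, by omega, fun i hi => ?_⟩
  rw [h.slack_spine _ hi]
  constructor
  · intro hir
    have := Nat.find_min' hex ⟨hi, hir⟩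
    omega
  · intro hki
    linarith [h.mono (show k ≤ i by omega) hi]

section Inside

variable {W : Finset V} {D r θ κ : ℝ} {j : ℕ} {w' : Sym2 V → ℝ} {d' : V → ℝ}

/-- A petal contains the shortest connections to the part of the spine inside it. -/
theorem isPotential_petal (h : IsPetalBase G X w q n d g)
    (hW : ∀ v, v ∈ W ↔ v ∈ X ∧ petalSlack D d g v ≤ r)
    (hj : ∀ i ≤ n, petalSlack D d g (q i) ≤ r ↔ j < i) :
    IsPotential G W (fun e => 2 * w e) {v | ∃ i, j < i ∧ i ≤ n ∧ q i = v} d g := by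
  refine ⟨?_, fun a ha b hb => h.petal.lipschitz a ((hW a).1 ha).1 b ((hW b).1 hb).1,
    fun v hv => ?_⟩
  · rintro _ ⟨i, _, hin, rfl⟩ _
    exact (h.petal_spine hin).le
  · obtain ⟨hvX, hvr⟩ := (hW v).1 hv
    rcases h.petal.tight v hvX with ⟨⟨i, hin, rfl⟩, he⟩ | ⟨a, ha, hadj, he⟩
    · exact Or.inl ⟨⟨i, (hj i hin).1 hvr, hin, rfl⟩, he⟩
    · refine Or.inr ⟨a, (hW a).2 ⟨ha, ?_⟩, hadj, he⟩
      have := h.pot.lipschitz a ha v hvX hadj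
      simp only [petalSlack] at hvr ⊢
      linarith

theorem spine_mem_petal (h : IsPetalBase G X w q n d g)
    (hW : ∀ v, v ∈ W ↔ v ∈ X ∧ petalSlack D d g v ≤ r)
    (hj : ∀ i ≤ n, petalSlack D d g (q i) ≤ r ↔ j < i)
    {i : ℕ} (hji : j < i) (hin : i ≤ n) : q i ∈ W :=
  (hW _).2 ⟨h.mem i hin, (hj i hin).2 hji⟩

theorem pos_of_le (h : IsPetalBase G X w q n d g)
    (hW : ∀ v, v ∈ W ↔ v ∈ X ∧ petalSlack D d g v ≤ r)
    (hθ : 0 < θ)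
    (hw' : ∀ a ∈ W, ∀ b ∈ W, G.Adj a b →
      θ * w s(a, b) ≤ w' s(a, b) ∧ w' s(a, b) ≤ w s(a, b))
    (a : V) (ha : a ∈ W) (b : V) (hb : b ∈ W) (hab : G.Adj a b) :
    0 < w' s(a, b) :=
  (mul_pos hθ (h.pos a ((hW a).1 ha).1 b ((hW b).1 hb).1 hab)).trans_le (hw' a ha b hb hab).1

/-- There is a distance function on a petal, measured from its entrance. -/
theorem exists_inner_potential (h : IsPetalBase G X w q n d g)
    (hW : ∀ v, v ∈ W ↔ v ∈ X ∧ petalSlack D d g v ≤ r)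
    (hj : ∀ i ≤ n, petalSlack D d g (q i) ≤ r ↔ j < i)
    (hθ : 0 < θ)
    (hw' : ∀ a ∈ W, ∀ b ∈ W, G.Adj a b →
      θ * w s(a, b) ≤ w' s(a, b) ∧ w' s(a, b) ≤ w s(a, b)) :
    ∃ d', IsPotential G W w' {q (j + 1)} (fun _ => 0) d' := by
  refine exists_isPotential G W w' _ _
    (fun a ha b hb hab => (h.pos_of_le hW hθ hw' a ha b hb hab).le) g fun v hv => ?_
  have hpos : ∀ a ∈ W, ∀ b ∈ W, G.Adj a b → 0 < 2 * w s(a, b) := fun a ha b hb hab => by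
    linarith [h.pos a ((hW a).1 ha).1 b ((hW b).1 hb).1 hab]
  rcases (h.isPotential_petal hW hj).rank hpos v hv with ⟨i, hji, hin, rfl⟩ | ha
  · rcases Nat.lt_or_ge (j + 1) i with hlt | hge
    · obtain ⟨k, rfl⟩ : ∃ k, i = k + 1 := ⟨i - 1, by omega⟩
      refine Or.inr ⟨q k, h.spine_mem_petal hW hj (by omega) (by omega), h.adj k (by omega), ?_⟩
      rw [h.petal_spine hin, h.petal_spine (by omega)]
      exact h.lt_of_lt (Nat.lt_succ_self k) hin
    · left
      rw [show i = j + 1 by omega]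
      rfl
  · exact Or.inr ha

theorem inner_spine_le (h : IsPetalBase G X w q n d g)
    (hW : ∀ v, v ∈ W ↔ v ∈ X ∧ petalSlack D d g v ≤ r)
    (hj : ∀ i ≤ n, petalSlack D d g (q i) ≤ r ↔ j < i)
    (hspine : ∀ i, j < i → i < n → w' s(q i, q (i + 1)) = θ * w s(q i, q (i + 1)))
    (hd' : IsPotential G W w' {q (j + 1)} (fun _ => 0) d')
    {i : ℕ} (hji : j < i) (hin : i ≤ n) :
    d' (q i) ≤ θ * (d (q i) - d (q (j + 1))) := by
  induction i, hji using Nat.le_induction with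
  | base =>
    simpa using hd'.le_source _ rfl (h.spine_mem_petal hW hj (Nat.lt_succ_self j) hin)
  | succ i hji ih =>
    have h1 := ih (by omega)
    have h2 := hd'.lipschitz _ (h.spine_mem_petal hW hj hji (by omega)) _
      (h.spine_mem_petal hW hj (by omega) hin) (h.adj i hin)
    rw [hspine i hji hin] at h2
    rw [h.step i hin]
    linarith

theorem le_inner (h : IsPetalBase G X w q n d g)
    (hW : ∀ v, v ∈ W ↔ v ∈ X ∧ petalSlack D d g v ≤ r)
    (hθ : 0 < θ)
    (hw' : ∀ a ∈ W, ∀ b ∈ W, G.Adj a b →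
      θ * w s(a, b) ≤ w' s(a, b) ∧ w' s(a, b) ≤ w s(a, b))
    (hd' : IsPotential G W w' {q (j + 1)} (fun _ => 0) d') :
    ∀ v ∈ W, θ * (d v - d (q (j + 1))) ≤ d' v := by
  refine hd'.induction (h.pos_of_le hW hθ hw') ?_ ?_
  · rintro _ - rfl hv
    simp [hv]
  · intro a ha v hv hadj he hle
    have h1 := mul_le_mul_of_nonneg_left
      (h.pot.lipschitz a ((hW a).1 ha).1 v ((hW v).1 hv).1 hadj) hθ.le
    linarith [(hw' a ha v hv hadj).1]

theorem inner_spine_eq (h : IsPetalBase G X w q n d g)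
    (hW : ∀ v, v ∈ W ↔ v ∈ X ∧ petalSlack D d g v ≤ r)
    (hj : ∀ i ≤ n, petalSlack D d g (q i) ≤ r ↔ j < i)
    (hθ : 0 < θ)
    (hw' : ∀ a ∈ W, ∀ b ∈ W, G.Adj a b →
      θ * w s(a, b) ≤ w' s(a, b) ∧ w' s(a, b) ≤ w s(a, b))
    (hspine : ∀ i, j < i → i < n → w' s(q i, q (i + 1)) = θ * w s(q i, q (i + 1)))
    (hd' : IsPotential G W w' {q (j + 1)} (fun _ => 0) d')
    {i : ℕ} (hji : j < i) (hin : i ≤ n) :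
    d' (q i) = θ * (d (q i) - d (q (j + 1))) :=
  le_antisymm (h.inner_spine_le hW hj hspine hd' hji hin)
    (h.le_inner hW hθ hw' hd' _ (h.spine_mem_petal hW hj hji hin))

theorem inner_le (h : IsPetalBase G X w q n d g)
    (hW : ∀ v, v ∈ W ↔ v ∈ X ∧ petalSlack D d g v ≤ r)
    (hj : ∀ i ≤ n, petalSlack D d g (q i) ≤ r ↔ j < i)
    (hw' : ∀ a ∈ W, ∀ b ∈ W, G.Adj a b →
      θ * w s(a, b) ≤ w' s(a, b) ∧ w' s(a, b) ≤ w s(a, b))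
    (hspine : ∀ i, j < i → i < n → w' s(q i, q (i + 1)) = θ * w s(q i, q (i + 1)))
    (hd' : IsPotential G W w' {q (j + 1)} (fun _ => 0) d')
    (hκ : ∀ i, j < i → i ≤ n →
      θ * (d (q i) - d (q (j + 1))) ≤ d (q i) / 2 + κ) :
    ∀ v ∈ W, d' v ≤ g v / 2 + κ := by
  refine (h.isPotential_petal hW hj).induction (fun a ha b hb hab => by
    linarith [h.pos a ((hW a).1 ha).1 b ((hW b).1 hb).1 hab]) ?_ ?_
  · rintro _ - ⟨i, hji, hin, rfl⟩ hg
    rw [hg]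
    exact (h.inner_spine_le hW hj hspine hd' hji hin).trans (hκ i hji hin)
  · intro a ha v hv hadj he hle
    linarith [hd'.lipschitz a ha v hv hadj, (hw' a ha v hv hadj).2]

/-- The part of the spine inside a petal is a spine of the petal. -/
theorem inner_isSpine (h : IsPetalBase G X w q n d g)
    (hW : ∀ v, v ∈ W ↔ v ∈ X ∧ petalSlack D d g v ≤ r)
    (hj : ∀ i ≤ n, petalSlack D d g (q i) ≤ r ↔ j < i)
    (hθ : 0 < θ)
    (hw' : ∀ a ∈ W, ∀ b ∈ W, G.Adj a b →
      θ * w s(a, b) ≤ w' s(a, b) ∧ w' s(a, b) ≤ w s(a, b))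
    (hspine : ∀ i, j < i → i < n → w' s(q i, q (i + 1)) = θ * w s(q i, q (i + 1)))
    (hd' : IsPotential G W w' {q (j + 1)} (fun _ => 0) d')
    (hjn : j < n) : IsSpine G W w' (fun i => q (i + (j + 1))) (n - (j + 1)) d' where
  pos := h.pos_of_le hW hθ hw'
  pot := by simpa using hd'
  mem i hi := h.spine_mem_petal hW hj (by omega) (by omega)
  adj i hi := by
    have := h.adj (i + (j + 1)) (by omega)
    rwa [show i + 1 + (j + 1) = i + (j + 1) + 1 by omega]
  step i hi := by
    rw [show i + 1 + (j + 1) = i + (j + 1) + 1 by omega,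
      h.inner_spine_eq hW hj hθ hw' hspine hd' (by omega) (by omega),
      h.inner_spine_eq hW hj hθ hw' hspine hd' (by omega) (by omega),
      hspine _ (by omega) (by omega), h.step _ (by omega)]
    ring

end Inside

end IsPetalBase

end Petals

/-! ### Clusters and their spanning trees -/

/-- A cluster of the decomposition: a spine whose weights agree with the original ones, except
that weights on the spine itself may have been halved. -/
structure IsCluster {V : Type} (G : SimpleGraph V) (w₀ : Sym2 V → ℝ) (X : Finset V)
    (w : Sym2 V → ℝ) (p : ℕ → V) (m : ℕ) (d : V → ℝ) : Prop extends IsSpine G X w p m d where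
  weight : ∀ a ∈ X, ∀ b ∈ X, G.Adj a b → w s(a, b) = w₀ s(a, b) ∨
    w s(a, b) = w₀ s(a, b) / 2 ∧ ∃ i < m, s(a, b) = s(p i, p (i + 1))

/-- A spanning tree of a cluster with small distances from the center, and even smaller distance
from the center to the end of the spine. -/
structure IsClusterTree {V : Type} (G : SimpleGraph V) (w₀ : Sym2 V → ℝ) (X : Finset V)
    (p : ℕ → V) (m : ℕ) (d : V → ℝ) (T : SimpleGraph V) : Prop where
  le : T ≤ G
  card : T.edgeSet.ncard + 1 ≤ X.card
  joined : ∀ v ∈ X, JoinedWithin T w₀ (p 0) v (4 * d v)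
  target : JoinedWithin T w₀ (p 0) (p m) (2 * d (p m))

section Clusters

variable {V : Type} {G : SimpleGraph V} {X : Finset V} {w₀ w : Sym2 V → ℝ} {p : ℕ → V} {m : ℕ}
  {d : V → ℝ}

theorem IsCluster.le (h : IsCluster G w₀ X w p m d) {a b : V} (ha : a ∈ X) (hb : b ∈ X)
    (hab : G.Adj a b) : w s(a, b) ≤ w₀ s(a, b) ∧ w₀ s(a, b) ≤ 2 * w s(a, b) := by
  have := h.pos a ha b hb hab
  rcases h.weight a ha b hb hab with he | ⟨he, -⟩ <;> constructor <;> linarith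

/-- Two subtrees joined by an edge have the right number of edges. -/
theorem ncard_edgeSet_sup_edge {T₁ T₂ : SimpleGraph V} {W Z : Finset V} [Finite V] [DecidableEq V]
    (h₁ : T₁.edgeSet.ncard + 1 ≤ W.card) (h₂ : T₂.edgeSet.ncard + 1 ≤ Z.card)
    (hdisj : Disjoint W Z) (hX : W ∪ Z = X) (a b : V) :
    (T₁ ⊔ T₂ ⊔ SimpleGraph.edge a b).edgeSet.ncard + 1 ≤ X.card := by
  have h3 : (SimpleGraph.edge a b).edgeSet.ncard ≤ 1 := by
    refine (Set.ncard_le_ncard (t := {s(a, b)}) ?_ (Set.finite_singleton _)).trans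
      (Set.ncard_singleton _).le
    exact SimpleGraph.edgeSet_edge_subset
  rw [SimpleGraph.edgeSet_sup, SimpleGraph.edgeSet_sup, ← hX, Finset.card_union_of_disjoint hdisj]
  have h4 := Set.ncard_union_le (T₁.edgeSet ∪ T₂.edgeSet) (SimpleGraph.edge a b).edgeSet
  have h5 := Set.ncard_union_le T₁.edgeSet T₂.edgeSet
  omega

/-- Every cut of a cluster, at a radius `r`, into two clusters whose spanning trees can be
combined. -/
def IsGoodCut {V : Type} (G : SimpleGraph V) (w₀ : Sym2 V → ℝ) (X : Finset V) (p : ℕ → V) (m : ℕ)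
    (d : V → ℝ) (W Z : Finset V) : Prop :=
  ∃ w₁ p₁ m₁ d₁ w₂ p₂ m₂ d₂, IsCluster G w₀ W w₁ p₁ m₁ d₁ ∧ IsCluster G w₀ Z w₂ p₂ m₂ d₂ ∧
    ∀ T₁ T₂, IsClusterTree G w₀ W p₁ m₁ d₁ T₁ → IsClusterTree G w₀ Z p₂ m₂ d₂ T₂ →
      ∃ T, T₁ ≤ T ∧ T₂ ≤ T ∧ IsClusterTree G w₀ X p m d T

/-- Combining the spanning trees of two clusters by an edge. -/
theorem IsClusterTree.combine [Finite V] {W Z : Finset V} {ρ : V → ℝ} {r : ℝ}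
    (hW : ∀ v, v ∈ W ↔ v ∈ X ∧ ρ v ≤ r) (hZ : ∀ v, v ∈ Z ↔ v ∈ X ∧ ¬ ρ v ≤ r)
    {p₁ p₂ : ℕ → V} {m₁ m₂ : ℕ} {d₁ d₂ : V → ℝ} {T₁ T₂ : SimpleGraph V}
    (h₁ : IsClusterTree G w₀ W p₁ m₁ d₁ T₁) (h₂ : IsClusterTree G w₀ Z p₂ m₂ d₂ T₂)
    {y : V} (hy : G.Adj y (p₁ 0)) (h0 : p₂ 0 = p 0) {L : ℝ}
    (hyL : JoinedWithin T₂ w₀ (p 0) y L)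
    (hdW : ∀ v ∈ W, L + w₀ s(y, p₁ 0) + 4 * d₁ v ≤ 4 * d v)
    (hdZ : ∀ v ∈ Z, d₂ v ≤ d v)
    (htarget : (p m = p₁ m₁ ∧ L + w₀ s(y, p₁ 0) + 2 * d₁ (p₁ m₁) ≤ 2 * d (p m)) ∨
      (p m = p₂ m₂ ∧ d₂ (p m) ≤ d (p m))) :
    ∃ T, T₁ ≤ T ∧ T₂ ≤ T ∧ IsClusterTree G w₀ X p m d T := by
  classical
  have hdisj : Disjoint W Z :=
    Finset.disjoint_left.2 fun v hv hv' => ((hZ v).1 hv').2 ((hW v).1 hv).2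
  have hX : W ∪ Z = X := by
    ext v
    rw [Finset.mem_union, hW, hZ]
    tauto
  have hle₁ : T₁ ≤ T₁ ⊔ T₂ ⊔ SimpleGraph.edge y (p₁ 0) := le_sup_left.trans le_sup_left
  have hle₂ : T₂ ≤ T₁ ⊔ T₂ ⊔ SimpleGraph.edge y (p₁ 0) := le_sup_right.trans le_sup_left
  have hcross : (T₁ ⊔ T₂ ⊔ SimpleGraph.edge y (p₁ 0)).Adj y (p₁ 0) :=
    Or.inr (by rw [SimpleGraph.edge_adj]; exact ⟨Or.inl ⟨rfl, rfl⟩, hy.ne⟩)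
  have hroot : JoinedWithin (T₁ ⊔ T₂ ⊔ SimpleGraph.edge y (p₁ 0)) w₀ (p 0) (p₁ 0)
      (L + w₀ s(y, p₁ 0)) := (hyL.mono hle₂ le_rfl).trans (.of_adj hcross)
  refine ⟨T₁ ⊔ T₂ ⊔ SimpleGraph.edge y (p₁ 0), hle₁, hle₂, ?_,
    ncard_edgeSet_sup_edge h₁.card h₂.card hdisj hX _ _, fun v hv => ?_, ?_⟩
  · exact sup_le (sup_le h₁.le h₂.le) ((SimpleGraph.edge_le_iff _).2 (Or.inr hy))
  · by_cases hvr : ρ v ≤ r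
    · have hvW := (hW v).2 ⟨hv, hvr⟩
      exact (hroot.trans ((h₁.joined v hvW).mono hle₁ le_rfl)).mono le_rfl (hdW v hvW)
    · have hvZ := (hZ v).2 ⟨hv, hvr⟩
      have := h₂.joined v hvZ
      rw [h0] at this
      exact this.mono hle₂ (by linarith [hdZ v hvZ])
  · rcases htarget with ⟨he, hL⟩ | ⟨he, hL⟩
    · have := hroot.trans (h₁.target.mono hle₁ le_rfl)
      rw [← he] at this hL
      exact this.mono le_rfl hL
    · have := h₂.target
      rw [h0, ← he] at this
      exact this.mono hle₂ (by linarith)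

/-- Cutting a petal off around the spine of the cluster. -/
theorem IsCluster.isGoodCut_along [Finite V] {g : V → ℝ} (h : IsCluster G w₀ X w p m d)
    (hg : IsPetalBase G X w p m d g) {r : ℝ} (hr0 : 0 ≤ r) (hr : 2 * r ≤ d (p m))
    (hpos : 0 < d (p m)) {W Z : Finset V}
    (hW : ∀ v, v ∈ W ↔ v ∈ X ∧ petalSlack (d (p m)) d g v ≤ r)
    (hZ : ∀ v, v ∈ Z ↔ v ∈ X ∧ ¬ petalSlack (d (p m)) d g v ≤ r) :
    IsGoodCut G w₀ X p m d W Z := by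
  obtain ⟨j, hjm, hj⟩ := hg.exists_crossing hr0 (by linarith)
  have hw' : ∀ a ∈ W, ∀ b ∈ W, G.Adj a b → 1 * w s(a, b) ≤ w s(a, b) ∧ w s(a, b) ≤ w s(a, b) :=
    fun a _ b _ _ => by simp
  have hspine : ∀ i, j < i → i < m → w s(p i, p (i + 1)) = 1 * w s(p i, p (i + 1)) :=
    fun i _ _ => (one_mul _).symm
  have hmemZ : ∀ i ≤ m, p i ∈ Z ↔ i ≤ j := fun i hi => by
    rw [hZ, hj i hi, not_lt, and_iff_right (h.mem i hi)]
  obtain ⟨d', hd'⟩ := hg.exists_inner_potential hW hj one_pos hw'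
  have hin := hg.inner_isSpine hW hj one_pos hw' hspine hd' hjm
  have hstep := h.step j hjm
  have hedge := h.le (h.mem j hjm.le) (h.mem (j + 1) hjm) (h.adj j hjm)
  refine ⟨w, _, _, d', w, p, j, d, ⟨hin, fun a ha b hb hab => ?_⟩,
    ⟨⟨fun a ha b hb => h.pos a ((hZ a).1 ha).1 b ((hZ b).1 hb).1, hg.isPotential_compl hZ,
      fun i hi => (hmemZ i (by omega)).2 hi, fun i hi => h.adj i (by omega),
      fun i hi => h.step i (by omega)⟩, fun a ha b hb hab => ?_⟩, ?_⟩
  · refine (h.weight a ((hW a).1 ha).1 b ((hW b).1 hb).1 hab).imp_right ?_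
    rintro ⟨he, i, him, hi⟩
    refine ⟨he, i - (j + 1), ?_⟩
    have hi' : p i ∈ W := by
      have : p i ∈ s(a, b) := hi ▸ Sym2.mem_mk_left _ _
      rcases Sym2.mem_iff.1 this with h1 | h1 <;> rw [h1] <;> assumption
    have hji : j < i := (hj i him.le).1 ((hW _).1 hi').2
    refine ⟨by omega, ?_⟩
    rw [hi, show i - (j + 1) + (j + 1) = i by omega,
      show i - (j + 1) + 1 + (j + 1) = i + 1 by omega]
  · refine (h.weight a ((hZ a).1 ha).1 b ((hZ b).1 hb).1 hab).imp_right ?_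
    rintro ⟨he, i, him, hi⟩
    refine ⟨he, i, ?_, hi⟩
    have hi' : p (i + 1) ∈ Z := by
      have : p (i + 1) ∈ s(a, b) := hi ▸ Sym2.mem_mk_right _ _
      rcases Sym2.mem_iff.1 this with h1 | h1 <;> rw [h1] <;> assumption
    have := (hmemZ (i + 1) him).1 hi'
    omega
  · intro T₁ T₂ hT₁ hT₂
    refine hT₁.combine hW hZ hT₂ (y := p j) (by simpa using h.adj j hjm) rfl hT₂.target ?_
      (fun _ _ => le_rfl) (Or.inl ⟨?_, ?_⟩)
    · intro v hv
      have h1 := hg.inner_le (κ := d (p m) / 2 - d (p (j + 1))) hW hj hw' hspine hd'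
        (fun i hji hi => by linarith [h.mono hi le_rfl]) v hv
      have h2 := ((hW v).1 hv).2
      have h3 := hg.le_of_slack_le (h.mem (j + 1) hjm) ((hj (j + 1) hjm).2 (Nat.lt_succ_self j))
      rw [petalSlack] at h2
      simp only [zero_add]
      linarith
    · simp only [show m - (j + 1) + (j + 1) = m by omega]
    · simp only [show m - (j + 1) + (j + 1) = m by omega, zero_add]
      have := hg.inner_spine_le hW hj hspine hd' hjm le_rfl
      linarith

/-- Cutting a petal off around a shortest path to a remote vertex. -/
theorem IsCluster.isGoodCut_remote [Finite V] {g : V → ℝ} {q : ℕ → V} {n : ℕ}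
    (h : IsCluster G w₀ X w p m d)
    (hg : IsPetalBase G X w q n d g) (hq : q 0 = p 0) {r : ℝ} (hr0 : 0 ≤ r)
    (hr : d (p m) < d (q n) - r) {W Z : Finset V}
    (hW : ∀ v, v ∈ W ↔ v ∈ X ∧ petalSlack (d (q n)) d g v ≤ r)
    (hZ : ∀ v, v ∈ Z ↔ v ∈ X ∧ ¬ petalSlack (d (q n)) d g v ≤ r) :
    IsGoodCut G w₀ X p m d W Z := by
  classical
  have hpm : 0 ≤ d (p m) := h.center ▸ h.mono m.zero_le le_rfl
  obtain ⟨j, hjn, hj⟩ := hg.exists_crossing hr0 (by linarith)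
  have hpZ : ∀ i ≤ m, p i ∈ Z := fun i hi => (hZ _).2 ⟨h.mem i hi, fun hir => by
    linarith [hg.le_of_slack_le (h.mem i hi) hir, h.mono hi le_rfl]⟩
  have hdisj : ∀ v ∈ W, v ∉ Z := fun v hv hv' => ((hZ v).1 hv').2 ((hW v).1 hv).2
  have hold : ∀ a ∈ X, ∀ b ∈ W, G.Adj a b → w s(a, b) = w₀ s(a, b) := by
    intro a ha b hb hab
    refine (h.weight a ha b ((hW b).1 hb).1 hab).resolve_right ?_
    rintro ⟨-, i, him, hi⟩
    have : b ∈ s(p i, p (i + 1)) := hi ▸ Sym2.mem_mk_right _ _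
    rcases Sym2.mem_iff.1 this with h1 | h1 <;> refine hdisj b hb (h1 ▸ hpZ _ (by omega))
  set w' : Sym2 V → ℝ := fun e => if ∃ i, j < i ∧ i < n ∧ e = s(q i, q (i + 1)) then
    1 / 2 * w e else w e with hw'def
  have hw' : ∀ a ∈ W, ∀ b ∈ W, G.Adj a b →
      1 / 2 * w s(a, b) ≤ w' s(a, b) ∧ w' s(a, b) ≤ w s(a, b) := by
    intro a ha b hb hab
    have := h.pos a ((hW a).1 ha).1 b ((hW b).1 hb).1 hab
    simp only [hw'def]
    split_ifs <;> constructor <;> linarith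
  have hspine : ∀ i, j < i → i < n → w' s(q i, q (i + 1)) = 1 / 2 * w s(q i, q (i + 1)) :=
    fun i hji hin => if_pos ⟨i, hji, hin, rfl⟩
  obtain ⟨d', hd'⟩ := hg.exists_inner_potential hW hj one_half_pos hw'
  have hin := hg.inner_isSpine hW hj one_half_pos hw' hspine hd' hjn
  have hx₁ : q (j + 1) ∈ W := hg.spine_mem_petal hW hj (Nat.lt_succ_self j) hjn
  have hyZ : q j ∈ Z := (hZ _).2 ⟨hg.mem j hjn.le, fun hh => lt_irrefl j ((hj j hjn.le).1 hh)⟩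
  have hedge := hold _ (hg.mem j hjn.le) _ hx₁ (hg.adj j hjn)
  have hedgepos := hg.pos _ (hg.mem j hjn.le) _ (hg.mem (j + 1) hjn) (hg.adj j hjn)
  refine ⟨w', _, _, d', w, p, m, d, ⟨hin, fun a ha b hb hab => ?_⟩,
    ⟨⟨fun a ha b hb => h.pos a ((hZ a).1 ha).1 b ((hZ b).1 hb).1,
      hq ▸ hg.isPotential_compl hZ, hpZ, h.adj, h.step⟩, fun a ha b hb hab =>
      h.weight a ((hZ a).1 ha).1 b ((hZ b).1 hb).1 hab⟩, ?_⟩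
  · have hab₀ := hold a ((hW a).1 ha).1 b hb hab
    by_cases hex : ∃ i, j < i ∧ i < n ∧ s(a, b) = s(q i, q (i + 1))
    · right
      refine ⟨by simp only [hw'def]; rw [if_pos hex, hab₀]; ring, ?_⟩
      obtain ⟨i, hji, hin', hi⟩ := hex
      refine ⟨i - (j + 1), by omega, ?_⟩
      rw [hi, show i - (j + 1) + (j + 1) = i by omega,
        show i - (j + 1) + 1 + (j + 1) = i + 1 by omega]
    · left
      simp only [hw'def]
      rw [if_neg hex, hab₀]
  · intro T₁ T₂ hT₁ hT₂
    refine hT₁.combine hW hZ hT₂ (y := q j) (by simpa using hg.adj j hjn) rfl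
      (hT₂.joined _ hyZ) ?_ (fun _ _ => le_rfl) (Or.inr ⟨rfl, le_rfl⟩)
    intro v hv
    have h1 := hg.inner_le (κ := - d (q (j + 1)) / 2) hW hj hw' hspine hd'
      (fun i hji hi => by linarith) v hv
    have h2 := ((hW v).1 hv).2
    have h3 := ((hZ _).1 hyZ).2
    rw [hg.slack_spine _ hjn.le] at h3
    rw [petalSlack] at h2
    have hstep := hg.step j hjn
    simp only [zero_add]
    linarith

/-- Every nontrivial cluster has a family of good cuts, at the thresholds of a Lipschitz
function. -/
theorem IsCluster.exists_isGoodCut [Finite V] (h : IsCluster G w₀ X w p m d) {Δ : ℝ}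
    (hΔ : 0 < Δ) (hatt : ∃ t ∈ X, d t = Δ) :
    ∃ ρ : V → ℝ, (∀ a ∈ X, ∀ b ∈ X, G.Adj a b → |ρ a - ρ b| ≤ 4 * w₀ s(a, b)) ∧
      (∃ v ∈ X, ρ v ≤ 0) ∧ (∃ v ∈ X, Δ / 4 < ρ v) ∧
      ∀ r ∈ Set.Icc 0 (Δ / 4), ∀ W Z : Finset V, (∀ v, v ∈ W ↔ v ∈ X ∧ ρ v ≤ r) →
        (∀ v, v ∈ Z ↔ v ∈ X ∧ ¬ ρ v ≤ r) → IsGoodCut G w₀ X p m d W Z := by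
  have hlip : ∀ {q n g}, IsPetalBase G X w q n d g → ∀ a ∈ X, ∀ b ∈ X, G.Adj a b →
      |petalSlack (d (q n)) d g a - petalSlack (d (q n)) d g b| ≤ 4 * w₀ s(a, b) :=
    fun hg a ha b hb hab => (hg.abs_slack_sub_le _ ha hb hab).trans
      (by linarith [(h.le ha hb hab).1])
  have hends : ∀ {q n g}, IsPetalBase G X w q n d g →
      petalSlack (d (q n)) d g (q n) = 0 ∧ petalSlack (d (q n)) d g (q 0) = d (q n) :=
    fun {q n g} hg => ⟨by rw [hg.slack_spine _ le_rfl, sub_self],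
      by rw [hg.slack_spine _ n.zero_le, hg.center, sub_zero]⟩
  rcases le_or_gt (Δ / 2) (d (p m)) with hD | hD
  · obtain ⟨g, hg⟩ := h.exists_petal_potential
    have hg : IsPetalBase G X w p m d g := ⟨h.toIsSpine, hg⟩
    refine ⟨petalSlack (d (p m)) d g, hlip hg, ⟨p m, h.mem m le_rfl, (hends hg).1.le⟩,
      ⟨p 0, h.mem 0 m.zero_le, by rw [(hends hg).2]; linarith⟩, fun r hr W Z hW hZ => ?_⟩
    exact h.isGoodCut_along hg hr.1 (by linarith [hr.2]) (by linarith) hW hZ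
  · obtain ⟨t, ht, htΔ⟩ := hatt
    obtain ⟨q, n, hq0, hqn, hqX, hq⟩ := h.pot.exists_path h.pos t ht
    have hspine : IsSpine G X w q n d :=
      ⟨h.pos, by rw [hq0]; exact h.pot, hqX, fun i hi => (hq i hi).1, fun i hi => (hq i hi).2⟩
    obtain ⟨g, hg⟩ := hspine.exists_petal_potential
    have hg : IsPetalBase G X w q n d g := ⟨hspine, hg⟩
    have hqΔ : d (q n) = Δ := by rw [hqn, htΔ]
    refine ⟨petalSlack (d (q n)) d g, hlip hg, ⟨q n, hqX n le_rfl, (hends hg).1.le⟩,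
      ⟨q 0, hqX 0 n.zero_le, by rw [(hends hg).2]; linarith⟩, fun r hr W Z hW hZ => ?_⟩
    exact h.isGoodCut_remote hg hq0 hr.1 (by linarith [hr.2]) hW hZ

end Clusters

section Induction

variable {V ι : Type} {G : SimpleGraph V} {w₀ : Sym2 V → ℝ} {K : Set V} {m F L : V → ℝ}

/-- Distances in a spanning tree of a cluster are controlled by its radius. -/
theorem IsClusterTree.wdist_le {X : Finset V} {p : ℕ → V} {n : ℕ} {d : V → ℝ}
    {T : SimpleGraph V} (hT : IsClusterTree G w₀ X p n d T) (hw₀ : ∀ e ∈ G.edgeSet, 0 < w₀ e)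
    {Δ : ℝ} (hΔ : ∀ v ∈ X, d v ≤ Δ) {u v : V} (hu : u ∈ X) (hv : v ∈ X) :
    wdist T w₀ u v ≤ 8 * Δ := by
  refine JoinedWithin.wdist_le (fun e he => (hw₀ e (SimpleGraph.edgeSet_mono hT.le he)).le) ?_
  exact ((hT.joined u hu).symm.trans (hT.joined v hv)).mono le_rfl
    (by linarith [hΔ u hu, hΔ v hv])

theorem IsClusterTree.reachable {X : Finset V} {p : ℕ → V} {n : ℕ} {d : V → ℝ}
    {T : SimpleGraph V} (hT : IsClusterTree G w₀ X p n d T) {u v : V} (hu : u ∈ X) (hv : v ∈ X) :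
    T.Reachable u v :=
  (hT.joined u hu).reachable.symm.trans (hT.joined v hv).reachable

open Classical in
/-- Every cluster has a spanning tree with small distances from its center, such that the total
cost of the pairs inside it is bounded by the entropy of the cluster. -/
theorem IsCluster.exists_tree [Finite V] (hw₀ : ∀ e ∈ G.edgeSet, 0 < w₀ e)
    (hs : IsScale K m F L) {Q : Finset ι} {o o' : ι → V} {c : ι → ℝ}
    (wk : ∀ P, G.Walk (o P) (o' P)) {ℓ : ι → ℝ}
    (hwk : ∀ P, ((wk P).edges.map w₀).sum ≤ ℓ P) (hc : ∀ P ∈ Q, 0 ≤ c P)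
    (hmass : ∀ v, ∑ P ∈ Q with o P = v, c P * ℓ P ≤ m v) :
    ∀ (N : ℕ) (X : Finset V), X.card = N → ∀ (w : Sym2 V → ℝ) (p : ℕ → V) (n : ℕ) (d : V → ℝ),
      IsCluster G w₀ X w p n d → ∃ T, IsClusterTree G w₀ X p n d T ∧
        ∑ P ∈ Q with ∀ x ∈ (wk P).support, x ∈ X, c P * wdist T w₀ (o P) (o' P) ≤
          65536 * clusterEntropy m L X + 4096 *
            ∑ P ∈ Q with ∀ x ∈ (wk P).support, x ∈ X, c P * (ℓ P * (F (o P) * L (o P))) := by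
  have hℓ : ∀ P, 0 ≤ ℓ P := fun P =>
    (walk_sum_nonneg (fun e he => (hw₀ e he).le) (wk P)).trans (hwk P)
  have hB : ∀ v, 0 ≤ F v * L v := fun v => zero_le_one.trans (hs.one_le_mul v)
  intro N
  induction N using Nat.strong_induction_on with
  | _ N ih =>
  intro X hX w p n d h
  have hp0 : p 0 ∈ X := h.mem 0 n.zero_le
  have hne : X.Nonempty := ⟨p 0, hp0⟩
  obtain ⟨t, ht, htmax⟩ := X.exists_max_image d hne
  have hd0 : ∀ v ∈ X, 0 ≤ d v := h.pot.nonneg h.pos (by simp)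
  rcases (hd0 t ht).eq_or_lt with hΔ | hΔ
  · have hall : ∀ v ∈ X, v = p 0 := by
      intro v hv
      rcases h.pot.tight v hv with ⟨hv0, -⟩ | ⟨a, ha, hadj, he⟩
      · exact hv0
      · linarith [h.pos a ha v hv hadj, hd0 a ha, htmax v hv]
    have hXs : X = {p 0} := Finset.eq_singleton_iff_unique_mem.2 ⟨hp0, hall⟩
    refine ⟨⊥, ⟨bot_le, by simp [hXs], ?_, ?_⟩, ?_⟩
    · intro v hv
      rw [hall v hv]
      exact .refl _ _ _ (by linarith [h.center])
    · rw [hall _ (h.mem n le_rfl)]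
      exact .refl _ _ _ (by linarith [h.center])
    · have hzero : ∀ P ∈ Q.filter fun P => ∀ x ∈ (wk P).support, x ∈ X,
          c P * wdist ⊥ w₀ (o P) (o' P) = 0 := by
        intro P hP
        have hP := (Finset.mem_filter.1 hP).2
        rw [hall _ (hP _ (wk P).start_mem_support), hall _ (hP _ (wk P).end_mem_support),
          wdist_self (by simp), mul_zero]
      rw [Finset.sum_eq_zero hzero]
      have h1 := hs.clusterEntropy_nonneg X
      have h2 : 0 ≤ ∑ P ∈ Q with ∀ x ∈ (wk P).support, x ∈ X,
          c P * (ℓ P * (F (o P) * L (o P))) := Finset.sum_nonneg fun P hP =>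
        mul_nonneg (hc P (Finset.mem_filter.1 hP).1) (mul_nonneg (hℓ P) (hB _))
      linarith
  · set Δ := d t with hΔdef
    obtain ⟨ρ, hρ, ⟨v₁, hv₁, hρ₁⟩, ⟨v₂, hv₂, hρ₂⟩, hcut⟩ := h.exists_isGoodCut hΔ ⟨t, ht, rfl⟩
    set QX := Q.filter fun P => ∀ x ∈ (wk P).support, x ∈ X with hQX
    set QS := QX.filter fun P => 128 * (ℓ P * (F (o P) * L (o P))) ≤ Δ / 4 with hQS
    have hQSQ : ∀ P ∈ QS, P ∈ Q := fun P hP =>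
      (Finset.mem_filter.1 (Finset.mem_filter.1 hP).1).1
    obtain ⟨r, hr, hsum⟩ := hs.exists_radius (X := X) (ρ := ρ) (α := 0) (β := Δ / 4) (Q := QS)
      (o := o) (c := c) (ℓ := ℓ) (by linarith) ⟨v₁, hv₁, hρ₁⟩ ⟨v₂, hv₂, hρ₂.le⟩
      (fun P hP => hc P (hQSQ P hP)) (fun P _ => hℓ P)
      (fun P hP => (Finset.mem_filter.1 (Finset.mem_filter.1 hP).1).2 _ (wk P).start_mem_support)
      (fun v _ => le_trans (Finset.sum_le_sum_of_subset_of_nonneg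
        (Finset.filter_subset_filter _ hQSQ) fun P hP _ =>
          mul_nonneg (hc P (Finset.mem_filter.1 hP).1) (hℓ P)) (hmass v))
      (fun P hP => by rw [sub_zero]; exact (Finset.mem_filter.1 hP).2)
    set W := X.filter fun v => ρ v ≤ r with hWdef
    set Z := X.filter fun v => ¬ ρ v ≤ r with hZdef
    have hW : ∀ v, v ∈ W ↔ v ∈ X ∧ ρ v ≤ r := fun v => Finset.mem_filter
    have hZ : ∀ v, v ∈ Z ↔ v ∈ X ∧ ¬ ρ v ≤ r := fun v => Finset.mem_filter
    obtain ⟨w₁, p₁, n₁, d₁, w₂, p₂, n₂, d₂, h₁, h₂, hcomb⟩ := hcut r hr W Z hW hZ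
    have hWX : W.card < N := hX ▸ Finset.card_lt_card (Finset.ssubset_iff_subset_ne.2
      ⟨Finset.filter_subset _ _, fun he => by
        have := ((hW v₂).1 (he ▸ hv₂)).2
        linarith [hr.2]⟩)
    have hZX : Z.card < N := hX ▸ Finset.card_lt_card (Finset.ssubset_iff_subset_ne.2
      ⟨Finset.filter_subset _ _, fun he => ((hZ v₁).1 (he ▸ hv₁)).2 (hρ₁.trans hr.1)⟩)
    obtain ⟨T₁, hT₁, hcost₁⟩ := ih _ hWX W rfl w₁ p₁ n₁ d₁ h₁
    obtain ⟨T₂, hT₂, hcost₂⟩ := ih _ hZX Z rfl w₂ p₂ n₂ d₂ h₂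
    obtain ⟨T, hle₁, hle₂, hT⟩ := hcomb T₁ T₂ hT₁ hT₂
    refine ⟨T, hT, ?_⟩
    have hTw : ∀ e ∈ T.edgeSet, 0 ≤ w₀ e := fun e he =>
      (hw₀ e (SimpleGraph.edgeSet_mono hT.le he)).le
    set QW := Q.filter fun P => ∀ x ∈ (wk P).support, x ∈ W with hQW
    set QZ := Q.filter fun P => ∀ x ∈ (wk P).support, x ∈ Z with hQZ
    set QC := QX.filter fun P => P ∉ QW ∧ P ∉ QZ with hQC
    have hdisj : Disjoint QW QZ := by
      rw [Finset.disjoint_left]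
      intro P hP hP'
      exact ((hZ _).1 ((Finset.mem_filter.1 hP').2 _ (wk P).start_mem_support)).2
        ((hW _).1 ((Finset.mem_filter.1 hP).2 _ (wk P).start_mem_support)).2
    have hdisj' : Disjoint (QW ∪ QZ) QC := by
      rw [Finset.disjoint_left]
      intro P hP hP'
      have := (Finset.mem_filter.1 hP').2
      rcases Finset.mem_union.1 hP with h | h
      · exact this.1 h
      · exact this.2 h
    have hQunion : QX = (QW ∪ QZ) ∪ QC := by
      ext P
      simp only [hQC, Finset.mem_union, Finset.mem_filter]
      constructor
      · tauto
      · rintro ((hP | hP) | hP)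
        · have hP := Finset.mem_filter.1 hP
          exact Finset.mem_filter.2 ⟨hP.1, fun x hx => ((hW x).1 (hP.2 x hx)).1⟩
        · have hP := Finset.mem_filter.1 hP
          exact Finset.mem_filter.2 ⟨hP.1, fun x hx => ((hZ x).1 (hP.2 x hx)).1⟩
        · exact hP.1
    have hsplit : ∀ f : ι → ℝ, ∑ P ∈ QX, f P =
        ∑ P ∈ QW, f P + ∑ P ∈ QZ, f P + ∑ P ∈ QC, f P := fun f => by
      rw [hQunion, Finset.sum_union hdisj', Finset.sum_union hdisj]
    have hcostW : ∑ P ∈ QW, c P * wdist T w₀ (o P) (o' P) ≤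
        ∑ P ∈ QW, c P * wdist T₁ w₀ (o P) (o' P) := by
      refine Finset.sum_le_sum fun P hP => ?_
      have hP := Finset.mem_filter.1 hP
      exact mul_le_mul_of_nonneg_left (wdist_anti hTw hle₁ (hT₁.reachable
        (hP.2 _ (wk P).start_mem_support) (hP.2 _ (wk P).end_mem_support))) (hc P hP.1)
    have hcostZ : ∑ P ∈ QZ, c P * wdist T w₀ (o P) (o' P) ≤
        ∑ P ∈ QZ, c P * wdist T₂ w₀ (o P) (o' P) := by
      refine Finset.sum_le_sum fun P hP => ?_
      have hP := Finset.mem_filter.1 hP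
      exact mul_le_mul_of_nonneg_left (wdist_anti hTw hle₂ (hT₂.reachable
        (hP.2 _ (wk P).start_mem_support) (hP.2 _ (wk P).end_mem_support))) (hc P hP.1)
    have hnear : ∀ P ∈ QC, |ρ (o P) - r| ≤ 4 * ℓ P := by
      intro P hP
      obtain ⟨hPX, hPW, hPZ⟩ := Finset.mem_filter.1 hP
      obtain ⟨hPQ, hPsup⟩ := Finset.mem_filter.1 hPX
      have hvar : ∀ x ∈ (wk P).support, |ρ (o P) - ρ x| ≤ 4 * ℓ P := fun x hx =>
        (abs_sub_le_mul_walk_sum (X := X) (by norm_num) (fun e he => (hw₀ e he).le)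
          hρ (wk P) hPsup hx).trans (by linarith [hwk P])
      have hx : ∃ x ∈ (wk P).support, ¬ ρ x ≤ r := by
        by_contra! hcon
        exact hPW (Finset.mem_filter.2 ⟨hPQ, fun x hx => (hW x).2 ⟨hPsup x hx, hcon x hx⟩⟩)
      have hy : ∃ y ∈ (wk P).support, ρ y ≤ r := by
        by_contra! hcon
        exact hPZ (Finset.mem_filter.2
          ⟨hPQ, fun x hx => (hZ x).2 ⟨hPsup x hx, not_le.2 (hcon x hx)⟩⟩)
      obtain ⟨x, hx, hxr⟩ := hx
      obtain ⟨y, hy, hyr⟩ := hy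
      have h1 := abs_le.1 (hvar x hx)
      have h2 := abs_le.1 (hvar y hy)
      rw [abs_le]
      constructor <;> linarith [h1.1, h1.2, h2.1, h2.2]
    have hcQC : ∀ P ∈ QC, 0 ≤ c P := fun P hP =>
      hc P (Finset.mem_filter.1 (Finset.mem_filter.1 hP).1).1
    have hcostC : ∑ P ∈ QC, c P * wdist T w₀ (o P) (o' P) ≤
        32 * ((Δ / 4 - 0) * ∑ P ∈ QS with |ρ (o P) - r| ≤ 4 * ℓ P, c P) +
          4096 * ∑ P ∈ QC, c P * (ℓ P * (F (o P) * L (o P))) := by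
      have hterm : ∀ P ∈ QC, c P * wdist T w₀ (o P) (o' P) ≤
          (if 128 * (ℓ P * (F (o P) * L (o P))) ≤ Δ / 4 then 8 * Δ * c P else 0) +
            4096 * (c P * (ℓ P * (F (o P) * L (o P)))) := by
        intro P hP
        have hPsup := (Finset.mem_filter.1 (Finset.mem_filter.1 hP).1).2
        have h1 := mul_le_mul_of_nonneg_left (hT.wdist_le hw₀ htmax
          (hPsup _ (wk P).start_mem_support) (hPsup _ (wk P).end_mem_support)) (hcQC P hP)
        have h2 := mul_nonneg (hcQC P hP) (mul_nonneg (hℓ P) (hB (o P)))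
        split_ifs with hlong
        · linarith
        · have h3 := mul_le_mul_of_nonneg_left (not_le.1 hlong).le (hcQC P hP)
          linarith
      refine (Finset.sum_le_sum hterm).trans ?_
      rw [Finset.sum_add_distrib, ← Finset.mul_sum, ← Finset.sum_filter, ← Finset.mul_sum]
      have hsub : ∑ P ∈ QC with 128 * (ℓ P * (F (o P) * L (o P))) ≤ Δ / 4, c P ≤
          ∑ P ∈ QS with |ρ (o P) - r| ≤ 4 * ℓ P, c P := by
        refine Finset.sum_le_sum_of_subset_of_nonneg (fun P hP => ?_) fun P hP _ =>
          hc P (hQSQ P (Finset.mem_filter.1 hP).1)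
        obtain ⟨hPC, hPs⟩ := Finset.mem_filter.1 hP
        exact Finset.mem_filter.2 ⟨Finset.mem_filter.2 ⟨(Finset.mem_filter.1 hPC).1, hPs⟩,
          hnear P hPC⟩
      have := mul_le_mul_of_nonneg_left hsub (show 0 ≤ 8 * Δ by linarith)
      linarith
    rw [hsplit, hsplit fun P => c P * (ℓ P * (F (o P) * L (o P)))]
    linarith

open Classical in
/-- A connected graph has a spanning tree whose weighted total stretch is bounded by the scale
parameters. -/
theorem exists_spanningTree_sum_le [Fintype V] (hG : G.Connected)
    (hw₀ : ∀ e ∈ G.edgeSet, 0 < w₀ e) (hs : IsScale K m F L) {c : V × V → ℝ}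
    (hc : ∀ P, 0 ≤ c P) (hmass : ∀ v, ∑ u, c (v, u) * wdist G w₀ v u ≤ m v) :
    ∃ T, T ≤ G ∧ T.IsTree ∧
      ∑ P, c P * wdist T w₀ P.1 P.2 ≤ 69632 * ∑ v, m v * (F v * L v) := by
  choose wk hwk using exists_walk_sum_le_wdist hG hw₀
  obtain ⟨x₀⟩ := hG.nonempty
  obtain ⟨d, hd⟩ := hG.exists_isPotential hw₀ x₀
  have hcluster : IsCluster G w₀ Finset.univ w₀ (fun _ => x₀) 0 d :=
    ⟨⟨fun a _ b _ hab => hw₀ _ hab, hd, fun _ _ => Finset.mem_univ _, by simp, by simp⟩,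
      fun _ _ _ _ _ => Or.inl rfl⟩
  have hfiber : ∀ (v : V) (f : V × V → ℝ), ∑ P with P.1 = v, f P = ∑ u, f (v, u) := by
    intro v f
    rw [Finset.sum_filter, Fintype.sum_prod_type, Finset.sum_eq_single v]
    · simp
    · intro a _ hav
      simp [hav]
    · simp
  obtain ⟨T, hT, hcost⟩ := IsCluster.exists_tree (ι := V × V) hw₀ hs (Q := Finset.univ)
    (o := Prod.fst) (o' := Prod.snd) (c := c) (fun P => wk P.1 P.2)
    (ℓ := fun P => wdist G w₀ P.1 P.2) (fun P => hwk P.1 P.2) (fun P _ => hc P)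
    (fun v => by rw [hfiber]; exact hmass v) _ _ rfl _ _ _ _ hcluster
  refine ⟨T, hT.le, ?_, ?_⟩
  · have hTconn : T.Connected := by
      have : Nonempty V := ⟨x₀⟩
      exact ⟨fun u v => hT.reachable (Finset.mem_univ u) (Finset.mem_univ v)⟩
    rw [SimpleGraph.isTree_iff_connected_and_card]
    refine ⟨hTconn, ?_⟩
    have h1 := hTconn.card_vert_le_card_edgeSet_add_one
    have h2 := hT.card
    rw [Finset.card_univ, ← Nat.card_eq_fintype_card] at h2
    rw [← Nat.card_coe_set_eq] at h2
    omega
  · simp only [Finset.mem_univ, implies_true, Finset.filter_true] at hcost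
    have h1 := hs.clusterEntropy_le Finset.univ
    have h2 : ∑ P : V × V, c P * (wdist G w₀ P.1 P.2 * (F P.1 * L P.1)) ≤
        ∑ v, m v * (F v * L v) := by
      rw [Fintype.sum_prod_type]
      refine Finset.sum_le_sum fun v _ => ?_
      calc ∑ u, c (v, u) * (wdist G w₀ v u * (F v * L v))
          = (∑ u, c (v, u) * wdist G w₀ v u) * (F v * L v) := by
            rw [Finset.sum_mul]
            exact Finset.sum_congr rfl fun u _ => by ring
        _ ≤ m v * (F v * L v) :=
            mul_le_mul_of_nonneg_right (hmass v) (zero_le_one.trans (hs.one_le_mul v))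
    linarith

end Induction

/-! ### From trees to distributions -/

/-- Linear programming duality: if for all nonnegative weights some point of a finite family has
weighted sum at most that of `b`, then a convex combination of the family is bounded by `b`. -/
theorem exists_convexCombination_le {ι τ : Type} [Fintype ι] [Fintype τ] (f : τ → ι → ℝ)
    (b : ι → ℝ) (h : ∀ c : ι → ℝ, (∀ i, 0 ≤ c i) → ∃ t, ∑ i, c i * f t i ≤ ∑ i, c i * b i) :
    ∃ x ∈ stdSimplex ℝ τ, ∀ i, ∑ t, x t * f t i ≤ b i := by
  classical
  set A : (τ → ℝ) →ₗ[ℝ] (ι → ℝ) := Fintype.linearCombination ℝ f with hA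
  have hAapp : ∀ x i, A x i = ∑ t, x t * f t i := fun x i => by
    simp [hA, Fintype.linearCombination_apply, Finset.sum_apply]
  by_contra! hcon
  have hdisj : Disjoint (A '' stdSimplex ℝ τ) (Set.Iic b) := by
    rw [Set.disjoint_left]
    rintro _ ⟨x, hx, rfl⟩ hle
    obtain ⟨i, hi⟩ := hcon x hx
    exact absurd (hle i) (not_le.2 (by rw [hAapp]; exact hi))
  obtain ⟨φ, u, v, hφu, huv, hvφ⟩ := geometric_hahn_banach_compact_closed
    ((convex_stdSimplex ℝ τ).linear_image A)
    ((isCompact_stdSimplex ℝ τ).image A.continuous_of_finiteDimensional)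
    (convex_Iic b) isClosed_Iic hdisj
  have hφ : ∀ z : ι → ℝ, φ z = ∑ i, z i * φ (Pi.single i 1) := by
    intro z
    conv_lhs => rw [pi_eq_sum_univ' z]
    simp [map_sum]
  have hneg : ∀ i, φ (Pi.single i 1) ≤ 0 := by
    intro i
    by_contra! hpos
    have hb := hvφ b Set.self_mem_Iic
    set s := (φ b - v) / φ (Pi.single i 1) with hs
    have hs0 : 0 < s := div_pos (by linarith) hpos
    have hmem : b - s • (Pi.single i 1 : ι → ℝ) ∈ Set.Iic b := by
      rw [Set.mem_Iic, sub_le_self_iff]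
      exact smul_nonneg hs0.le (Pi.single_nonneg.2 zero_le_one)
    have h1 := hvφ _ hmem
    rw [map_sub, map_smul, smul_eq_mul, hs, div_mul_cancel₀ _ hpos.ne'] at h1
    linarith
  obtain ⟨t, ht⟩ := h (fun i => -φ (Pi.single i 1)) fun i => neg_nonneg.2 (hneg i)
  have h1 : φ (f t) < u := by
    refine hφu _ ⟨Pi.single t 1, single_mem_stdSimplex ℝ t, ?_⟩
    simp [hA]
  have h2 := hvφ b Set.self_mem_Iic
  have h3 : ∀ z : ι → ℝ, ∑ i, -φ (Pi.single i 1) * z i = -φ z := fun z => by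
    rw [hφ, ← Finset.sum_neg_distrib]
    exact Finset.sum_congr rfl fun i _ => by ring
  rw [h3, h3] at ht
  linarith

/-! ### Terminal distortion -/

/-- The distortion `log x * log (log x)`. -/
noncomputable def nearLog (x : ℝ) : ℝ := Real.log x * Real.log (Real.log x)

theorem exp_one_lt_log {x : ℝ} (hx : 16 ≤ x) : Real.exp 1 < Real.log x := by
  have h1 : Real.log 16 ≤ Real.log x := Real.log_le_log (by norm_num) hx
  have h2 : Real.log 16 = 4 * Real.log 2 := by
    rw [show (16 : ℝ) = 2 ^ 4 by norm_num, Real.log_pow]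
    norm_num
  linarith [Real.exp_one_lt_d9, Real.log_two_gt_d9]

theorem one_lt_log_log {x : ℝ} (hx : 16 ≤ x) : 1 < Real.log (Real.log x) :=
  (Real.lt_log_iff_exp_lt ((Real.exp_pos 1).trans (exp_one_lt_log hx))).2 (exp_one_lt_log hx)

theorem one_lt_log {x : ℝ} (hx : 16 ≤ x) : 1 < Real.log x :=
  (Real.one_lt_exp_iff.2 one_pos).trans (exp_one_lt_log hx)

theorem log_log_mono {x y : ℝ} (hx : 16 ≤ x) (hxy : x ≤ y) :
    Real.log (Real.log x) ≤ Real.log (Real.log y) :=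
  Real.log_le_log (by linarith [one_lt_log hx]) (Real.log_le_log (by linarith) hxy)

theorem nearLog_mono {x y : ℝ} (hx : 16 ≤ x) (hxy : x ≤ y) : nearLog x ≤ nearLog y :=
  mul_le_mul (Real.log_le_log (by linarith) hxy) (log_log_mono hx hxy)
    (by linarith [one_lt_log_log hx]) (by linarith [one_lt_log (hx.trans hxy)])

theorem one_le_nearLog {x : ℝ} (hx : 16 ≤ x) : 1 ≤ nearLog x :=
  one_le_mul_of_one_le_of_one_le (one_lt_log hx).le (one_lt_log_log hx).le

theorem nearLog_le_sq {x : ℝ} (hx : 16 ≤ x) : nearLog x ≤ x ^ 2 := by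
  have h1 := Real.log_le_self (show 0 ≤ x by linarith)
  have h2 := Real.log_le_self (show 0 ≤ Real.log x by linarith [one_lt_log hx])
  rw [sq]
  exact mul_le_mul h1 (h2.trans h1) (by linarith [one_lt_log_log hx]) (by linarith)

section Distortion

variable {V : Type} [Fintype V]

open Classical in
/-- The number governing the distortion at a vertex: the number of terminals for a terminal, the
number of all vertices otherwise. -/
noncomputable def levelSize (K : Finset V) (v : V) : ℝ :=
  if v ∈ K then (K.card : ℝ) else (Fintype.card V : ℝ)

variable {K : Finset V}

theorem card_le_levelSize (K : Finset V) (v : V) : (K.card : ℝ) ≤ levelSize K v := by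
  unfold levelSize
  split_ifs
  · exact le_rfl
  · exact_mod_cast K.card_le_univ

theorem levelSize_le_card (K : Finset V) (v : V) : levelSize K v ≤ Fintype.card V := by
  unfold levelSize
  split_ifs
  · exact_mod_cast K.card_le_univ
  · exact le_rfl

theorem sum_inv_levelSize_le (K : Finset V) : ∑ v, (levelSize K v)⁻¹ ≤ 2 := by
  classical
  have h1 : ∑ v, (levelSize K v)⁻¹ ≤
      ∑ v, ((if v ∈ K then (K.card : ℝ)⁻¹ else 0) + (Fintype.card V : ℝ)⁻¹) := by
    refine Finset.sum_le_sum fun v _ => ?_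
    unfold levelSize
    split_ifs
    · have : (0 : ℝ) ≤ (Fintype.card V : ℝ)⁻¹ := by positivity
      linarith
    · rw [zero_add]
  refine h1.trans ?_
  rw [Finset.sum_add_distrib, Finset.sum_ite_mem, Finset.univ_inter, Finset.sum_const,
    Finset.sum_const, nsmul_eq_mul, nsmul_eq_mul, Finset.card_univ]
  linarith [mul_inv_le_one (a := (K.card : ℝ)), mul_inv_le_one (a := (Fintype.card V : ℝ))]

/-- Regularized masses satisfy the requirements of the cluster decomposition. -/
theorem exists_isScale (hK : 16 ≤ K.card) {s : V → ℝ} (hs : ∀ v, 0 ≤ s v) {A : ℝ} (hA : 0 < A)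
    (hsum : ∑ v, s v * nearLog (levelSize K v) ≤ A) :
    ∃ m : V → ℝ, IsScale (K : Set V) m (fun v => 8 * Real.log (levelSize K v))
        (fun v => 5 * Real.log (Real.log (levelSize K v))) ∧ (∀ v, s v ≤ m v) ∧
      ∑ v, m v * nearLog (levelSize K v) ≤ 3 * A := by
  have hK' : (16 : ℝ) ≤ K.card := by exact_mod_cast hK
  have hκ : ∀ v, (16 : ℝ) ≤ levelSize K v := fun v => hK'.trans (card_le_levelSize K v)
  have hβ : ∀ v, 1 ≤ nearLog (levelSize K v) := fun v => one_le_nearLog (hκ v)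
  set m : V → ℝ := fun v => s v + A / (levelSize K v * nearLog (levelSize K v)) with hm
  have hextra : ∀ v, 0 < A / (levelSize K v * nearLog (levelSize K v)) := fun v =>
    div_pos hA (mul_pos (by linarith [hκ v]) (by linarith [hβ v]))
  have hpos : ∀ v, 0 < m v := fun v => add_pos_of_nonneg_of_pos (hs v) (hextra v)
  have htotal : ∑ v, m v * nearLog (levelSize K v) ≤ 3 * A := by
    have h1 : ∀ v, m v * nearLog (levelSize K v) =
        s v * nearLog (levelSize K v) + A * (levelSize K v)⁻¹ := fun v => by
      have := hκ v
      have := hβ v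
      simp only [hm]
      field_simp
    simp only [h1]
    rw [Finset.sum_add_distrib, ← Finset.mul_sum]
    nlinarith [sum_inv_levelSize_le K]
  have hmass : (∑ v, m v) * nearLog K.card ≤ 3 * A := by
    refine le_trans ?_ htotal
    rw [Finset.sum_mul]
    exact Finset.sum_le_sum fun v _ => mul_le_mul_of_nonneg_left
      (nearLog_mono hK' (card_le_levelSize K v)) (hpos v).le
  refine ⟨m, ⟨hpos, fun v => ?_, fun v => ?_, fun v hv u => ?_, fun v hv u => ?_,
    fun X v hv => ?_⟩, fun v => by simp only [hm]; linarith [hextra v], htotal⟩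
  · linarith [one_lt_log (hκ v)]
  · have h1 := one_lt_log (hκ v)
    have h2 := one_lt_log_log (hκ v)
    rw [Real.log_mul (by norm_num) (by linarith), show (8 : ℝ) = 2 ^ 3 by norm_num, Real.log_pow]
    push_cast
    linarith [Real.log_two_lt_d9]
  · have h1 : levelSize K v = K.card := if_pos (Finset.mem_coe.1 hv)
    have h2 := card_le_levelSize K u
    have h3 := hκ v
    rw [h1] at h3 ⊢
    exact ⟨by linarith [Real.log_le_log (by linarith) h2], by linarith [log_log_mono h3 h2]⟩
  · have h1 : levelSize K v = Fintype.card V := if_neg fun h => hv (Finset.mem_coe.2 h)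
    have h2 := levelSize_le_card K u
    have h3 := hκ u
    rw [h1]
    exact ⟨by linarith [Real.log_le_log (by linarith) h2], by linarith [log_log_mono h3 h2]⟩
  · have h1 := hκ v
    have h2 := hβ v
    have h4 : (∑ u ∈ X, m u) / m v ≤ levelSize K v ^ 4 := by
      rw [div_le_iff₀ (hpos v)]
      have h5 : ∑ u ∈ X, m u ≤ ∑ u, m u :=
        Finset.sum_le_sum_of_subset_of_nonneg X.subset_univ fun u _ _ => (hpos u).le
      have h6 : ∑ u, m u ≤ 3 * A := by
        have : 0 ≤ ∑ u, m u := Finset.sum_nonneg fun u _ => (hpos u).le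
        nlinarith [one_le_nearLog hK']
      have h7 : 3 * A ≤ levelSize K v ^ 4 * (A / (levelSize K v * nearLog (levelSize K v))) := by
        rw [← mul_div_assoc, le_div_iff₀ (mul_pos (by linarith) (by linarith))]
        have h8 := nearLog_le_sq h1
        have h9 : 3 * (levelSize K v * nearLog (levelSize K v)) ≤ levelSize K v ^ 4 := by
          calc 3 * (levelSize K v * nearLog (levelSize K v))
              ≤ levelSize K v * (levelSize K v * levelSize K v ^ 2) := by
                gcongr
                linarith
            _ = _ := by ring
        nlinarith
      have h10 : A / (levelSize K v * nearLog (levelSize K v)) ≤ m v := by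
        simp only [hm]
        linarith [hs v]
      have := mul_le_mul_of_nonneg_left h10 (show 0 ≤ levelSize K v ^ 4 by positivity)
      linarith
    have h11 : 0 < ∑ u ∈ X, m u := Finset.sum_pos (fun u _ => hpos u) ⟨v, hv⟩
    have h12 := Real.log_le_log (div_pos h11 (hpos v)) h4
    rw [Real.log_pow] at h12
    push_cast at h12
    linarith

theorem eq_of_wdist_eq_zero {G : SimpleGraph V} {w : Sym2 V → ℝ} (hG : G.Connected)
    (hw : ∀ e ∈ G.edgeSet, 0 < w e) {u v : V} (h : wdist G w u v ≤ 0) : u = v := by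
  obtain ⟨p, hp⟩ := exists_walk_sum_le_wdist hG hw u v
  cases p with
  | nil => rfl
  | cons hadj q =>
    have h1 := walk_sum_nonneg (fun e he => (hw e he).le) q
    have h2 := hw _ (G.mem_edgeSet.2 hadj)
    simp only [SimpleGraph.Walk.edges_cons, List.map_cons, List.sum_cons] at hp
    linarith

/-- For every weighting of the pairs of vertices, some spanning tree has small total distance. -/
theorem exists_spanningTree_terminal {G : SimpleGraph V} {w : Sym2 V → ℝ} (hG : G.Connected)
    (hw : ∀ e ∈ G.edgeSet, 0 < w e) (hK : 16 ≤ K.card) {c : V × V → ℝ} (hc : ∀ P, 0 ≤ c P) :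
    ∃ T, (T ≤ G ∧ T.IsTree) ∧ ∑ P, c P * wdist T w P.1 P.2 ≤
      ∑ P, c P * (8355840 * nearLog (levelSize K P.1) * wdist G w P.1 P.2) := by
  have hd : ∀ u v, 0 ≤ wdist G w u v := wdist_nonneg fun e he => (hw e he).le
  have hβ : ∀ v, 1 ≤ nearLog (levelSize K v) := fun v => one_le_nearLog
    ((by exact_mod_cast hK : (16 : ℝ) ≤ K.card).trans (card_le_levelSize K v))
  have hterm : ∀ P : V × V, 0 ≤ c P * (nearLog (levelSize K P.1) * wdist G w P.1 P.2) :=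
    fun P => mul_nonneg (hc P) (mul_nonneg (by linarith [hβ P.1]) (hd _ _))
  set A := ∑ P, c P * (nearLog (levelSize K P.1) * wdist G w P.1 P.2) with hA
  have hrhs : ∑ P, c P * (8355840 * nearLog (levelSize K P.1) * wdist G w P.1 P.2) =
      8355840 * A := by
    rw [hA, Finset.mul_sum]
    exact Finset.sum_congr rfl fun _ _ => by ring
  rw [hrhs]
  have hA_nonneg : 0 ≤ A := Finset.sum_nonneg fun P _ => hterm P
  rcases hA_nonneg.eq_or_lt with hA0 | hApos
  · obtain ⟨T, hT, hTtree⟩ := hG.exists_isTree_le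
    refine ⟨T, ⟨hT, hTtree⟩, ?_⟩
    rw [← hA0, mul_zero]
    refine (Finset.sum_eq_zero fun P hP => ?_).le
    have h0 := (Finset.sum_eq_zero_iff_of_nonneg fun P _ => hterm P).1 hA0.symm P hP
    rcases mul_eq_zero.1 h0 with h0 | h0
    · rw [h0, zero_mul]
    · have h1 := (mul_eq_zero.1 h0).resolve_left (by linarith [hβ P.1])
      rw [eq_of_wdist_eq_zero hG hw h1.le,
        wdist_self fun e he => (hw e (SimpleGraph.edgeSet_mono hT he)).le, mul_zero]
  · obtain ⟨m, hscale, hsm, hmA⟩ := exists_isScale (K := K) hK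
      (s := fun v => ∑ u, c (v, u) * wdist G w v u)
      (fun v => Finset.sum_nonneg fun u _ => mul_nonneg (hc _) (hd _ _)) hApos (by
        rw [hA, Fintype.sum_prod_type]
        refine Finset.sum_le_sum fun v _ => ?_
        rw [Finset.sum_mul]
        exact (Finset.sum_congr rfl fun u _ => by ring).le)
    obtain ⟨T, hT, hTtree, hcost⟩ := exists_spanningTree_sum_le hG hw hscale hc hsm
    refine ⟨T, ⟨hT, hTtree⟩, hcost.trans ?_⟩
    have h1 : ∑ v, m v * (8 * Real.log (levelSize K v) *
        (5 * Real.log (Real.log (levelSize K v)))) =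
        40 * ∑ v, m v * nearLog (levelSize K v) := by
      rw [Finset.mul_sum]
      exact Finset.sum_congr rfl fun v _ => by rw [nearLog]; ring
    rw [h1]
    linarith

/-- A distribution over spanning trees whose expected distances are bounded in terms of the
first vertex of each pair. -/
theorem exists_distribution_terminal {G : SimpleGraph V} {w : Sym2 V → ℝ} (hG : G.Connected)
    (hw : ∀ e ∈ G.edgeSet, 0 < w e) (hK : 16 ≤ K.card) :
    ∃ (N : ℕ) (prob : Fin N → ℝ) (T : Fin N → SimpleGraph V),
      (∀ i, 0 ≤ prob i) ∧ (∑ i, prob i) = 1 ∧ (∀ i, T i ≤ G ∧ (T i).IsTree) ∧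
      ∀ u v, ∑ i, prob i * wdist (T i) w u v ≤
        8355840 * nearLog (levelSize K u) * wdist G w u v := by
  classical
  let τ := {T : SimpleGraph V // T ≤ G ∧ T.IsTree}
  have : Fintype τ := Fintype.ofFinite τ
  obtain ⟨x, hx, hle⟩ := exists_convexCombination_le
    (fun (T : τ) (P : V × V) => wdist T.1 w P.1 P.2)
    (fun P => 8355840 * nearLog (levelSize K P.1) * wdist G w P.1 P.2) fun c hc => by
      obtain ⟨T, hT, hcost⟩ := exists_spanningTree_terminal hG hw hK hc
      exact ⟨⟨T, hT⟩, hcost⟩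
  let e := (Fintype.equivFin τ).symm
  refine ⟨Fintype.card τ, fun i => x (e i), fun i => (e i).1, fun i => hx.1 _, ?_,
    fun i => (e i).2, fun u v => ?_⟩
  · rw [e.sum_comp]
    exact hx.2
  · rw [e.sum_comp fun T : τ => x T * wdist T.1 w u v]
    exact hle (u, v)

end Distortion

theorem probabilistic_spanning_tree_strong_terminal :
    ∃ C : ℝ, 0 < C ∧
      ∀ (V : Type) [Fintype V] (G : SimpleGraph V) (w : Sym2 V → ℝ) (K : Finset V),
        G.Connected → (∀ e ∈ G.edgeSet, 0 < w e) →
        16 ≤ Fintype.card V → 16 ≤ K.card →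
        ∃ (N : ℕ) (prob : Fin N → ℝ) (T : Fin N → SimpleGraph V),
          (∀ i, 0 ≤ prob i) ∧ (∑ i, prob i) = 1 ∧
          (∀ i, prob i ≠ 0 → T i ≤ G ∧ (T i).IsTree) ∧
          (∀ v ∈ K, ∀ u : V,
            (∑ i, prob i * wdist (T i) w v u) ≤
              C * Real.log K.card * Real.log (Real.log K.card) *
                Real.log (Real.log (Real.log K.card)) * wdist G w v u) ∧
          (∀ u x : V,
            (∑ i, prob i * wdist (T i) w u x) ≤
              C * Real.log (Fintype.card V) * Real.log (Real.log (Fintype.card V)) *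
                Real.log (Real.log (Real.log (Fintype.card V))) * wdist G w u x) := by
  set c₀ := Real.log (Real.log (Real.log 16)) with hc₀
  have hc₀pos : 0 < c₀ := Real.log_pos (one_lt_log_log le_rfl)
  refine ⟨8355840 / c₀, div_pos (by norm_num) hc₀pos, ?_⟩
  intro V _ G w K hG hw hV hK
  have hV' : (16 : ℝ) ≤ Fintype.card V := by exact_mod_cast hV
  have hK' : (16 : ℝ) ≤ K.card := by exact_mod_cast hK
  obtain ⟨N, prob, T, h0, h1, hT, hdist⟩ := exists_distribution_terminal hG hw hK
  have hfinal : ∀ (x : ℝ) (u v : V), 16 ≤ x → levelSize K u ≤ x →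
      ∑ i, prob i * wdist (T i) w u v ≤
        8355840 / c₀ * Real.log x * Real.log (Real.log x) * Real.log (Real.log (Real.log x)) *
          wdist G w u v := by
    intro x u v hx hux
    refine (hdist u v).trans (mul_le_mul_of_nonneg_right ?_
      (wdist_nonneg (fun e he => (hw e he).le) u v))
    have h2 : nearLog (levelSize K u) ≤ nearLog x :=
      nearLog_mono (hK'.trans (card_le_levelSize K u)) hux
    have h3 : c₀ ≤ Real.log (Real.log (Real.log x)) :=
      Real.log_le_log (by linarith [one_lt_log_log (le_refl (16 : ℝ))]) (log_log_mono le_rfl hx)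
    have h4 := one_le_nearLog hx
    calc 8355840 * nearLog (levelSize K u) ≤ 8355840 / c₀ * nearLog x * c₀ := by
          rw [mul_right_comm, div_mul_cancel₀ _ hc₀pos.ne']
          linarith
      _ ≤ 8355840 / c₀ * nearLog x * Real.log (Real.log (Real.log x)) :=
          mul_le_mul_of_nonneg_left h3 (by positivity)
      _ = _ := by rw [nearLog]; ring
  refine ⟨N, prob, T, h0, h1, fun i _ => hT i, fun v hv u => ?_, fun u x => ?_⟩
  · exact hfinal _ v u hK' (by rw [levelSize, if_pos hv])
  · exact hfinal _ u x hV' (levelSize_le_card K u)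
end
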